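/- Let I = [a,b] and let F : I → I be a PM function with forts c_1 < … < c_v (c_0 := a, c_{v+1} := b) and let 1 ≤ k ≤ v−1, with F(I) ⊆ [c_k,c_{k+1}] (so H(F) = 1 and K(F) = [c_k,c_{k+1}]) and F strictly increasing on [c_k,c_{k+1}]. Assume condition (K_0^+) fails, i.e., there exists x ∈ I with F(x) = c_k and F(c_k) ≠ c_k, or there exists x ∈ I with F(x) = c_{k+1} and F(c_{k+1}) ≠ c_{k+1}. Suppose the restriction of F to [c_k,c_{k+1}] is reversing-correspondence, and that one of the following chains of inequalities holds: (i) c_k = F(c_{k+2}) < F(c_k) < F(c_{k+1}) = F(c_{k−1}) < c_{k+1}; or (ii) c_k < F(c_{k+2}) < F(c_k) < F(c_{k+1}) < F(c_{k−1}) < c_{k+1}; or (iii) c_k < F(c_{k+2}) = F(c_k) < F(c_{k+1}) < F(c_{k−1}) = c_{k+1}. Suppose further that there exist indices ℓ_0 := k−1 > ℓ_1 > … > ℓ_s > ℓ_{s+1} := 0 such that: F(c_{ℓ_j}) = F(c_{k−1}) for 0 ≤ j ≤ s with j ≡ 0 or 1 (mod 4) and F(c_{ℓ_j}) = F(c_{k+2})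 for 0 ≤ j ≤ s with j ≡ 2 or 3 (mod 4); max_{x∈[c_{ℓ_{j+1}},c_{ℓ_j}]} F(x) = F(c_{k−1}) for 0 ≤ j ≤ s with j ≡ 0, 1 or 3 (mod 4); and min_{x∈[c_{ℓ_{j+1}},c_{ℓ_j}]} F(x) = F(c_{k+2}) for 0 ≤ j ≤ s with j ≡ 1, 2 or 3 (mod 4); and that there exist indices r_0 := k+2 < r_1 < … < r_t < r_{t+1} := v+1 such that: F(c_{r_j}) = F(c_{k+2}) for 0 ≤ j ≤ t with j ≡ 0 or 1 (mod 4) and F(c_{r_j}) = F(c_{k−1}) for 0 ≤ j ≤ t with j ≡ 2 or 3 (mod 4); min_{x∈[c_{r_j},c_{r_{j+1}}]} F(x) = F(c_{k+2}) for 0 ≤ j ≤ t with j ≡ 0, 1 or 3 (mod 4); and max_{x∈[c_{r_j},c_{r_{j+1}}]} F(x) = F(c_{k−1}) for 0 ≤ j ≤ t with j ≡ 1, 2 or 3 (mod 4). Then F has a continuous iterative root f of order 2 (f : I → I continuous with f∘f = F) such that f is strictly decreasing on [c_k,c_{k+1}] and H(f) = 2. -/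

import Mathlib

open Set Function

noncomputable section

/-- `x` is a fort of `F` on `[a,b]`: `F` is not strictly monotone on any
neighborhood of `x` in `[a,b]`. -/
def IsFort (a b : ℝ) (F : ℝ → ℝ) (x : ℝ) : Prop :=
  x ∈ Set.Icc a b ∧ ∀ ε : ℝ, 0 < ε →
    ¬ StrictMonoOn F (Set.Icc a b ∩ Set.Ioo (x - ε) (x + ε)) ∧
    ¬ StrictAntiOn F (Set.Icc a b ∩ Set.Ioo (x - ε) (x + ε))

/-- The number of forts `N(F)` of `F` on `[a,b]`. -/
noncomputable def nForts (a b : ℝ) (F : ℝ → ℝ) : ℕ :=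
  {x | IsFort a b F x}.ncard

/-- `H(F) = m`: the nonmonotonicity height of `F` on `[a,b]` equals `m`, i.e. `m` is
the least `i ≥ 0` with `N(F^i) = N(F^{i+1})`. -/
def HeightEq (a b : ℝ) (F : ℝ → ℝ) (m : ℕ) : Prop :=
  IsLeast {i : ℕ | nForts a b (F^[i]) = nForts a b (F^[i + 1])} m

/-- `F` is a PM function on `[a,b]` with forts `c 1 < ... < c v`
(`c 0 = a`, `c (v+1) = b`): `F` is continuous, maps `[a,b]` into itself,
is strictly monotone on each lap `[c i, c (i+1)]`, and each `c i`, `1 ≤ i ≤ v`,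
is a fort. -/
structure PMFun (a b : ℝ) (F : ℝ → ℝ) (v : ℕ) (c : ℕ → ℝ) : Prop where
  lt : a < b
  cont : ContinuousOn F (Set.Icc a b)
  maps : Set.MapsTo F (Set.Icc a b) (Set.Icc a b)
  c_zero : c 0 = a
  c_last : c (v + 1) = b
  c_mono : ∀ i ≤ v, c i < c (i + 1)
  lap_mono : ∀ i ≤ v,
    StrictMonoOn F (Set.Icc (c i) (c (i + 1))) ∨ StrictAntiOn F (Set.Icc (c i) (c (i + 1)))
  fort : ∀ i, 1 ≤ i → i ≤ v → IsFort a b F (c i)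

/-- `[d,e]` is a lap of `G` on `[a,b]`: a maximal interval of strict monotonicity,
bounded by forts or the endpoints of `[a,b]`, with no fort inside. -/
def IsLap (a b : ℝ) (G : ℝ → ℝ) (d e : ℝ) : Prop :=
  a ≤ d ∧ d < e ∧ e ≤ b ∧
  (StrictMonoOn G (Set.Icc d e) ∨ StrictAntiOn G (Set.Icc d e)) ∧
  (d = a ∨ IsFort a b G d) ∧ (e = b ∨ IsFort a b G e) ∧
  ∀ x ∈ Set.Ioo d e, ¬ IsFort a b G x

/-- The set of fixed points of `φ` in `[α,β]`. -/
def fixedSet (α β : ℝ) (φ : ℝ → ℝ) : Set ℝ := {x | x ∈ Set.Icc α β ∧ φ x = x}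

/-- `φ` is a reversing-correspondence on `[α,β]`. -/
def RevCorr (α β : ℝ) (φ : ℝ → ℝ) : Prop :=
  StrictMonoOn φ (Set.Icc α β) ∧ ContinuousOn φ (Set.Icc α β) ∧
  Set.MapsTo φ (Set.Icc α β) (Set.Icc α β) ∧
  ∃ ξ ∈ fixedSet α β φ, ∃ ω : ℝ → ℝ,
    Set.MapsTo ω (fixedSet α β φ) (fixedSet α β φ) ∧
    StrictAntiOn ω (fixedSet α β φ) ∧
    Set.SurjOn ω (fixedSet α β φ) (fixedSet α β φ) ∧
    ω ξ = ξ ∧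
    ((α ∈ fixedSet α β φ ∧ β ∈ fixedSet α β φ) ∨
      (α ∉ fixedSet α β φ ∧ β ∉ fixedSet α β φ)) ∧
    (∀ ξ₁ ∈ fixedSet α β φ, ∀ ξ₂ ∈ fixedSet α β φ, ξ₁ < ξ₂ → ξ₂ ≤ ξ →
      (∀ z ∈ Set.Ioo ξ₁ ξ₂, z ∉ fixedSet α β φ) →
      ∀ x ∈ Set.Ioo ξ₁ ξ₂, ∀ y ∈ Set.Ioo (ω ξ₂) (ω ξ₁),
        (φ x - x) * (φ y - y) < 0)

/-- A strictly increasing continuous function on `[α, β]` extends to an order isomorphism of `ℝ`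
with explicit behaviour outside `[α, β]`. -/
theorem exists_orderIso_extension {F : ℝ → ℝ} {α β δ δ' : ℝ} (hαβ : α ≤ β)
    (hc : ContinuousOn F (Icc α β)) (hm : StrictMonoOn F (Icc α β))
    (hδ : 0 ≤ δ) (hδ' : 0 ≤ δ') :
    ∃ e : ℝ ≃o ℝ, (∀ x ∈ Icc α β, e x = F x) ∧
      (∀ x ≤ α, e x = F α + (x - α) + max (-δ) (x - α)) ∧
      (∀ x, β ≤ x → e x = F β + (x - β) + min δ' (x - β)) := by
  set P : ℝ → ℝ := fun x => max α (min β x) with hP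
  have hPc : Continuous P := by fun_prop
  have hPm : ∀ x, P x ∈ Icc α β := fun x =>
    ⟨le_max_left _ _, max_le hαβ (min_le_left _ _)⟩
  set E : ℝ → ℝ := fun x => F (P x) + (x - P x) + max (-δ) (min δ' (x - P x)) with hE
  have hEc : Continuous E := by
    have : Continuous fun x => F (P x) := hc.comp_continuous hPc hPm
    exact (this.add (continuous_id.sub hPc)).add
      (continuous_const.max (continuous_const.min (continuous_id.sub hPc)))
  have hmid : ∀ x ∈ Icc α β, E x = F x := by
    intro x hx
    have : P x = x := by simp [hP, hx.1, hx.2]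
    simp [hE, this, hδ, hδ']
  have hleft : ∀ x ≤ α, E x = F α + (x - α) + max (-δ) (x - α) := by
    intro x hx
    have : P x = α := by simp [hP, hx]
    have h2 : min δ' (x - α) = x - α := min_eq_right (by linarith)
    simp [hE, this, h2]
  have hright : ∀ x, β ≤ x → E x = F β + (x - β) + min δ' (x - β) := by
    intro x hx
    have : P x = β := by simp [hP, hx, hαβ]
    have h2 : max (-δ) (min δ' (x - β)) = min δ' (x - β) :=
      max_eq_right (le_min (by linarith) (by linarith))
    simp [hE, this, h2]
  have hEm : StrictMono E := by
    intro x y hxy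
    have h1 : P x ≤ P y := max_le_max le_rfl (min_le_min le_rfl hxy.le)
    have h2 : x - P x ≤ y - P y := by
      simp only [hP]
      rcases le_total β x with h | h <;> rcases le_total β y with h' | h' <;>
        rcases le_total α x with h3 | h3 <;> rcases le_total α y with h4 | h4 <;>
        simp [*] <;> linarith
    have h3 : max (-δ) (min δ' (x - P x)) ≤ max (-δ) (min δ' (y - P y)) :=
      max_le_max le_rfl (min_le_min le_rfl h2)
    simp only [hE]
    rcases h1.eq_or_lt with h | h
    · rw [h] at h3 h2 ⊢
      linarith
    · have := hm (hPm x) (hPm y) h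
      linarith
  have hEs : Surjective E := by
    intro y
    refine mem_range_of_exists_le_of_exists_ge hEc
      ⟨min α (α + y - F α), ?_⟩ ⟨max β (β + y - F β), ?_⟩
    · rw [hleft _ (min_le_left _ _)]
      have h1 := min_le_right α (α + y - F α)
      have h2 : max (-δ) (min α (α + y - F α) - α) ≤ 0 :=
        max_le (by linarith) (by linarith [min_le_left α (α + y - F α)])
      linarith
    · rw [hright _ (le_max_left _ _)]
      have h1 := le_max_right β (β + y - F β)
      have h2 : 0 ≤ min δ' (max β (β + y - F β) - β) :=
        le_min hδ' (by linarith [le_max_left β (β + y - F β)])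
      linarith
  exact ⟨hEm.orderIsoOfSurjective E hEs, hmid, hleft, hright⟩

theorem OrderIso.zpow_add_one_apply {α : Type*} [Preorder α] (e : α ≃o α) (n : ℤ) (x : α) :
    (e ^ (n + 1)) x = e ((e ^ n) x) := by
  rw [add_comm, zpow_one_add]
  rfl

/-- Every point of a gap of the fixed point set lies in a unique translate of a fundamental
domain. -/
theorem exists_zpow_le_lt {e : ℝ ≃o ℝ} {u w x₀ x : ℝ}
    (hup : ∀ x ∈ Ioo u w, x < e x) (hO : ∀ n : ℤ, (e ^ n) x₀ ∈ Ioo u w) (hx : x ∈ Ioo u w) :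
    ∃ n : ℤ, (e ^ n) x₀ ≤ x ∧ x < (e ^ (n + 1)) x₀ := by
  have hmono : StrictMono fun n : ℤ => (e ^ n) x₀ := by
    refine strictMono_int_of_lt_succ fun n => ?_
    rw [e.zpow_add_one_apply]
    exact hup _ (hO n)
  have himg : e '' range (fun n : ℤ => (e ^ n) x₀) = range fun n : ℤ => (e ^ n) x₀ := by
    ext y
    constructor
    · rintro ⟨_, ⟨n, rfl⟩, rfl⟩
      exact ⟨n + 1, e.zpow_add_one_apply n x₀⟩
    · rintro ⟨n, rfl⟩
      refine ⟨_, ⟨n - 1, rfl⟩, ?_⟩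
      simp only
      rw [← e.zpow_add_one_apply, sub_add_cancel]
  have habove : ∃ n : ℤ, x < (e ^ n) x₀ := by
    by_contra! h
    have hlub := isLUB_csSup (range_nonempty fun n : ℤ => (e ^ n) x₀)
      ⟨x, by rintro _ ⟨n, rfl⟩; exact h n⟩
    have h2 := e.isLUB_image'.2 hlub
    rw [himg] at h2
    have h3 := h2.unique hlub
    have h4 := hup _ ⟨(hO 0).1.trans_le (hlub.1 ⟨0, rfl⟩),
      (hlub.2 (by rintro _ ⟨n, rfl⟩; exact h n)).trans_lt hx.2⟩
    exact h4.ne' h3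
  have hbelow : ∃ n : ℤ, (e ^ n) x₀ ≤ x := by
    by_contra! h
    have hglb := isGLB_csInf (range_nonempty fun n : ℤ => (e ^ n) x₀)
      ⟨x, by rintro _ ⟨n, rfl⟩; exact (h n).le⟩
    have h2 := e.isGLB_image'.2 hglb
    rw [himg] at h2
    have h3 := h2.unique hglb
    have h4 := hup _ ⟨hx.1.trans_le (hglb.2 (by rintro _ ⟨n, rfl⟩; exact (h n).le)),
      (hglb.1 ⟨0, rfl⟩).trans_lt (hO 0).2⟩
    exact h4.ne' h3
  obtain ⟨m, hm⟩ := habove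
  obtain ⟨n, hn, hn'⟩ := Int.exists_greatest_of_bdd (P := fun n : ℤ => (e ^ n) x₀ ≤ x)
    ⟨m, fun z hz => (hmono.lt_iff_lt.1 (hz.trans_lt hm)).le⟩ hbelow
  refine ⟨n, hn, ?_⟩
  by_contra! h
  linarith [hn' _ h]

/-- A strictly increasing bijection between `[0, 1]` and `[x₀, x₂]` whose value at `1 / 2` is
prescribed. -/
theorem exists_strictMonoOn_unitInterval {x₀ x₁ x₂ : ℝ} (h01 : x₀ < x₁) (h12 : x₁ < x₂) :
    ∃ B : ℝ → ℝ, StrictMonoOn B (Icc 0 1) ∧ ContinuousOn B (Icc 0 1) ∧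
      B 0 = x₀ ∧ B (1 / 2) = x₁ ∧ B 1 = x₂ := by
  have hd : 0 < x₁ - x₀ := sub_pos.2 h01
  have he : 0 < x₂ - x₁ := sub_pos.2 h12
  have hpos : ∀ t ∈ Icc (0 : ℝ) 1, 0 < (1 - t) * (x₂ - x₁) + t * (x₁ - x₀) := by
    rintro t ⟨ht0, ht1⟩
    rcases ht0.eq_or_lt with rfl | ht0
    · linarith
    · have := mul_pos ht0 hd
      have := mul_nonneg (sub_nonneg.2 ht1) he.le
      linarith
  refine ⟨fun t => x₀ + (x₂ - x₀) * (x₁ - x₀) * (t / ((1 - t) * (x₂ - x₁) + t * (x₁ - x₀))),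
    ?_, ?_, ?_, ?_, ?_⟩
  · intro t ht s hs hts
    have hlt : t / ((1 - t) * (x₂ - x₁) + t * (x₁ - x₀)) <
        s / ((1 - s) * (x₂ - x₁) + s * (x₁ - x₀)) := by
      rw [div_lt_div_iff₀ (hpos t ht) (hpos s hs)]
      nlinarith
    have : 0 < (x₂ - x₀) * (x₁ - x₀) := mul_pos (by linarith) hd
    simp only
    gcongr
  · have : ContinuousOn (fun t : ℝ => t / ((1 - t) * (x₂ - x₁) + t * (x₁ - x₀))) (Icc 0 1) :=
      ContinuousOn.div (by fun_prop) (by fun_prop) fun t ht => (hpos t ht).ne'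
    fun_prop
  · simp
  · have : (1 - 1 / 2) * (x₂ - x₁) + 1 / 2 * (x₁ - x₀) = (x₂ - x₀) / 2 := by ring
    simp only [this]
    have : x₂ - x₀ ≠ 0 := by linarith
    field_simp
    ring
  · simp only [sub_self, zero_mul, one_mul, zero_add]
    field_simp
    ring

/-- Solution of Abel's equation: on a gap of its fixed point set, an order isomorphism of `ℝ`
lying above the identity is conjugate to the translation by `1`. -/
theorem exists_translation_coordinate {e : ℝ ≃o ℝ} {u w x₀ x₁ : ℝ} (hu : e u = u) (hw : e w = w)
    (hup : ∀ x ∈ Ioo u w, x < e x) (h0 : x₀ ∈ Ioo u w) (h01 : x₀ < x₁) (h1 : x₁ < e x₀) :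
    ∃ S : ℝ → ℝ, StrictMono S ∧ (∀ t, S (t + 1) = e (S t)) ∧ range S = Ioo u w ∧
      S 0 = x₀ ∧ S (1 / 2) = x₁ := by
  have hO : ∀ x ∈ Ioo u w, ∀ n : ℤ, (e ^ n) x ∈ Ioo u w := by
    intro x hx n
    have hfix : ∀ {y}, e y = y → (e ^ n) y = y := by
      intro y hy
      induction n using Int.induction_on with
      | zero => rfl
      | succ n ih => rw [e.zpow_add_one_apply, ih, hy]
      | pred n ih =>
        have := e.zpow_add_one_apply (-n - 1) y
        rw [sub_add_cancel, ih] at this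
        exact e.injective (this.symm.trans hy.symm)
    constructor
    · simpa [hfix hu] using (e ^ n).lt_iff_lt.2 hx.1
    · simpa [hfix hw] using (e ^ n).lt_iff_lt.2 hx.2
  obtain ⟨B, hBm, hBc, hB0, hBh, hB1⟩ := exists_strictMonoOn_unitInterval h01 h1
  have hfr : ∀ t : ℝ, Int.fract t ∈ Icc (0 : ℝ) 1 := fun t =>
    ⟨Int.fract_nonneg t, (Int.fract_lt_one t).le⟩
  have hBlow : ∀ t : ℝ, x₀ ≤ B (Int.fract t) := fun t => by
    rw [← hB0]
    exact hBm.monotoneOn ⟨le_rfl, zero_le_one⟩ (hfr t) (hfr t).1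
  have hBhigh : ∀ t : ℝ, B (Int.fract t) < e x₀ := fun t => by
    rw [← hB1]
    exact hBm (hfr t) ⟨zero_le_one, le_rfl⟩ (Int.fract_lt_one t)
  have hBmem : ∀ t : ℝ, B (Int.fract t) ∈ Ioo u w := fun t =>
    ⟨h0.1.trans_le (hBlow t), (hBhigh t).trans (by simpa [hw] using e.lt_iff_lt.2 h0.2)⟩
  have hmono : Monotone fun n : ℤ => (e ^ n) x₀ := by
    refine monotone_int_of_le_succ fun n => ?_
    rw [e.zpow_add_one_apply]
    exact (hup _ (hO _ h0 n)).le
  refine ⟨fun t => (e ^ ⌊t⌋) (B (Int.fract t)), ?_, ?_, ?_, ?_, ?_⟩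
  · intro t s hts
    simp only
    rcases (Int.floor_mono hts.le).eq_or_lt with h | h
    · rw [← h]
      refine (e ^ ⌊t⌋).lt_iff_lt.2 (hBm (hfr t) (hfr s) ?_)
      rw [Int.fract, Int.fract, ← h]
      linarith
    · calc (e ^ ⌊t⌋) (B (Int.fract t)) < (e ^ ⌊t⌋) (e x₀) := (e ^ ⌊t⌋).lt_iff_lt.2 (hBhigh t)
        _ = (e ^ (⌊t⌋ + 1)) x₀ := by rw [zpow_add_one]; rfl
        _ ≤ (e ^ ⌊s⌋) x₀ := hmono (by omega)
        _ ≤ (e ^ ⌊s⌋) (B (Int.fract s)) := (e ^ ⌊s⌋).le_iff_le.2 (hBlow s)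
  · intro t
    simp only [Int.floor_add_one, Int.fract_add_one]
    exact e.zpow_add_one_apply _ _
  · apply Subset.antisymm
    · rintro _ ⟨t, rfl⟩
      exact hO _ (hBmem t) _
    · intro x hx
      obtain ⟨n, hn, hn'⟩ := exists_zpow_le_lt hup (hO _ h0) hx
      have hy : (e ^ n).symm x ∈ Icc (B 0) (B 1) := by
        rw [hB0, hB1]
        constructor
        · rwa [OrderIso.le_symm_apply]
        · rw [OrderIso.symm_apply_le]
          rw [zpow_add_one] at hn'
          exact hn'.le
      obtain ⟨t, ht, hBt⟩ := intermediate_value_Icc zero_le_one hBc hy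
      have ht1 : t < 1 := by
        refine lt_of_le_of_ne ht.2 ?_
        rintro rfl
        rw [hB1] at hBt
        rw [zpow_add_one] at hn'
        have : x = (e ^ n) (e x₀) := by rw [hBt]; simp
        exact hn'.ne this
      refine ⟨n + t, ?_⟩
      have h1 : ⌊(n : ℝ) + t⌋ = n := by
        rw [Int.floor_intCast_add, Int.floor_eq_zero_iff.2 ⟨ht.1, ht1⟩, add_zero]
      have h2 : Int.fract ((n : ℝ) + t) = t := by
        rw [Int.fract_intCast_add, Int.fract_eq_self.2 ⟨ht.1, ht1⟩]
      simp only [h1, h2, hBt]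
      simp
  · simp [hB0]
  · have h1 : ⌊(1 / 2 : ℝ)⌋ = 0 := by norm_num
    have h2 : Int.fract (1 / 2 : ℝ) = 1 / 2 := Int.fract_eq_self.2 (by norm_num)
    simp only [h1, h2, hBh]
    simp

/-- `ψ` is a decreasing bijection from `(u, w)` onto `(u', w')` commuting with `e`. -/
def GapConj (e : ℝ ≃o ℝ) (u w u' w' : ℝ) (ψ : ℝ → ℝ) : Prop :=
  StrictAntiOn ψ (Ioo u w) ∧ ψ '' Ioo u w = Ioo u' w' ∧ ∀ x ∈ Ioo u w, ψ (e x) = e (ψ x)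

theorem GapConj.of_symm {e : ℝ ≃o ℝ} {u w u' w' : ℝ} {ψ : ℝ → ℝ} (hu : e u = u) (hw : e w = w)
    (h : GapConj e.symm u w u' w' ψ) : GapConj e u w u' w' ψ := by
  refine ⟨h.1, h.2.1, fun x hx => ?_⟩
  have hex : e x ∈ Ioo u w :=
    ⟨by simpa [hu] using e.lt_iff_lt.2 hx.1, by simpa [hw] using e.lt_iff_lt.2 hx.2⟩
  have := h.2.2 _ hex
  rw [OrderIso.symm_apply_apply] at this
  rw [this, OrderIso.apply_symm_apply]

theorem exists_gapConj_of_coordinates {e : ℝ ≃o ℝ} {u w u' w' : ℝ} {S S' : ℝ → ℝ}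
    (hS : StrictMono S) (hS' : StrictMono S') (hSe : ∀ t, S (t + 1) = e (S t))
    (hSe' : ∀ t, S' (t + 1) = e.symm (S' t)) (hSr : range S = Ioo u w)
    (hSr' : range S' = Ioo u' w') (r : ℝ) :
    ∃ ψ, GapConj e u w u' w' ψ ∧ ∀ t, ψ (S t) = S' (r - t) := by
  have hψ : ∀ t, S' (r - invFun S (S t)) = S' (r - t) := fun t => by
    rw [leftInverse_invFun hS.injective t]
  refine ⟨fun x => S' (r - invFun S x), ⟨?_, ?_, ?_⟩, hψ⟩
  · rw [← hSr]
    rintro _ ⟨t, rfl⟩ _ ⟨s, rfl⟩ hts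
    simp only [hψ]
    exact hS' (by linarith [hS.lt_iff_lt.1 hts])
  · rw [← hSr, ← hSr']
    ext y
    constructor
    · rintro ⟨_, ⟨t, rfl⟩, rfl⟩
      exact ⟨_, rfl⟩
    · rintro ⟨t, rfl⟩
      refine ⟨S (r - t), ⟨_, rfl⟩, ?_⟩
      simp only [hψ, sub_sub_cancel]
  · rw [← hSr]
    rintro _ ⟨t, rfl⟩
    rw [← hSe]
    simp only [hψ]
    have := hSe' (r - (t + 1))
    rw [show r - (t + 1) + 1 = r - t by ring] at this
    rw [this, OrderIso.apply_symm_apply]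

theorem exists_gapConj_marked {e : ℝ ≃o ℝ} {u w u' w' α β p q : ℝ} (hu : e u = u) (hw : e w = w)
    (hu' : e u' = u') (hw' : e w' = w') (hup : ∀ x ∈ Ioo u w, x < e x)
    (hdown : ∀ y ∈ Ioo u' w', e y < y) (hα : α ∈ Ioo u w) (hβ : β ∈ Ioo u' w')
    (hpq : (α < p ∧ p < e α ∧ e β < q ∧ q < β) ∨ (p = α ∧ q = e β) ∨ (p = e α ∧ q = β)) :
    ∃ ψ, GapConj e u w u' w' ψ ∧ ψ α = q ∧ ψ p = e β := by
  have hdown' : ∀ y ∈ Ioo u' w', y < e.symm y := fun y hy => by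
    rw [OrderIso.lt_symm_apply]
    exact hdown y hy
  have heβ : e β ∈ Ioo u' w' :=
    ⟨by simpa [hu'] using e.lt_iff_lt.2 hβ.1, (hdown β hβ).trans hβ.2⟩
  have key : ∀ x₁ y₁, α < x₁ → x₁ < e α → e β < y₁ → y₁ < β → ∀ r : ℝ,
      ∃ ψ S S' : ℝ → ℝ,
      GapConj e u w u' w' ψ ∧ (∀ t, ψ (S t) = S' (r - t)) ∧ S 0 = α ∧ S (1 / 2) = x₁ ∧
        S 1 = e α ∧ S' 0 = e β ∧ S' (1 / 2) = y₁ ∧ S' 1 = β := by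
    intro x₁ y₁ h1 h2 h3 h4 r
    obtain ⟨S, hS, hSe, hSr, hS0, hSh⟩ := exists_translation_coordinate hu hw hup hα h1 h2
    obtain ⟨S', hS', hSe', hSr', hS0', hSh'⟩ := exists_translation_coordinate (e := e.symm)
      (by rw [OrderIso.symm_apply_eq, hu']) (by rw [OrderIso.symm_apply_eq, hw']) hdown' heβ h3
      (by rwa [OrderIso.symm_apply_apply])
    obtain ⟨ψ, hψ, hψS⟩ := exists_gapConj_of_coordinates hS hS' hSe hSe' hSr hSr' r
    refine ⟨ψ, S, S', hψ, hψS, hS0, hSh, ?_, hS0', hSh', ?_⟩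
    · rw [← hS0, ← hSe, zero_add]
    · rw [← zero_add (1 : ℝ), hSe', hS0', OrderIso.symm_apply_apply]
  rcases hpq with ⟨h1, h2, h3, h4⟩ | ⟨rfl, rfl⟩ | ⟨rfl, rfl⟩
  · obtain ⟨ψ, S, S', hψ, hψS, hS0, hSh, -, hS0', hSh', -⟩ := key p q h1 h2 h3 h4 (1 / 2)
    refine ⟨ψ, hψ, ?_, ?_⟩
    · rw [← hS0, hψS, sub_zero, hSh']
    · rw [← hSh, hψS, sub_self, hS0']
  · obtain ⟨x₁, h1, h2⟩ := exists_between (hup p hα)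
    obtain ⟨y₁, h3, h4⟩ := exists_between (hdown β hβ)
    obtain ⟨ψ, S, S', hψ, hψS, hS0, -, -, hS0', -, -⟩ := key x₁ y₁ h1 h2 h3 h4 0
    refine ⟨ψ, hψ, ?_, ?_⟩ <;> rw [← hS0, hψS, sub_zero, hS0']
  · obtain ⟨x₁, h1, h2⟩ := exists_between (hup α hα)
    obtain ⟨y₁, h3, h4⟩ := exists_between (hdown q hβ)
    obtain ⟨ψ, S, S', hψ, hψS, hS0, -, hS1, hS0', -, hS1'⟩ := key x₁ y₁ h1 h2 h3 h4 1
    refine ⟨ψ, hψ, ?_, ?_⟩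
    · rw [← hS0, hψS, sub_zero, hS1']
    · rw [← hS1, hψS, sub_self, hS0']

theorem exists_gapConj {e : ℝ ≃o ℝ} {u w u' w' : ℝ} (hu : e u = u) (hw : e w = w)
    (hu' : e u' = u') (hw' : e w' = w') (huw : u < w) (huw' : u' < w')
    (hdir : ((∀ x ∈ Ioo u w, x < e x) ∧ ∀ y ∈ Ioo u' w', e y < y) ∨
      ((∀ x ∈ Ioo u w, e x < x) ∧ ∀ y ∈ Ioo u' w', y < e y)) :
    ∃ ψ, GapConj e u w u' w' ψ := by
  obtain ⟨α, hα⟩ := exists_between huw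
  obtain ⟨β, hβ⟩ := exists_between huw'
  rcases hdir with ⟨hup, hdown⟩ | ⟨hdown, hup⟩
  · obtain ⟨ψ, hψ, -⟩ :=
      exists_gapConj_marked hu hw hu' hw' hup hdown hα hβ (.inr (.inl ⟨rfl, rfl⟩))
    exact ⟨ψ, hψ⟩
  · obtain ⟨ψ, hψ, -⟩ := exists_gapConj_marked (e := e.symm) (u := u) (w := w) (u' := u') (w' := w')
      (by rw [OrderIso.symm_apply_eq, hu]) (by rw [OrderIso.symm_apply_eq, hw])
      (by rw [OrderIso.symm_apply_eq, hu']) (by rw [OrderIso.symm_apply_eq, hw'])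
      (fun x hx => by rw [OrderIso.lt_symm_apply]; exact hdown x hx)
      (fun x hx => by rw [OrderIso.symm_apply_lt]; exact hup x hx) hα hβ (.inr (.inl ⟨rfl, rfl⟩))
    exact ⟨ψ, hψ.of_symm hu hw⟩

/-- `u < w` are consecutive fixed points of `e`. -/
def ConsecFixed (e : ℝ → ℝ) (u w : ℝ) : Prop :=
  e u = u ∧ e w = w ∧ u < w ∧ ∀ z ∈ Ioo u w, e z ≠ z

theorem exists_consecFixed {e : ℝ → ℝ} (he : Continuous e) {x : ℝ} (hx : e x ≠ x)
    (hlo : ∃ z ≤ x, e z = z) (hhi : ∃ z, x ≤ z ∧ e z = z) :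
    ∃ u w, ConsecFixed e u w ∧ x ∈ Ioo u w := by
  have hcl : IsClosed {z | e z = z} := isClosed_eq he continuous_id
  obtain ⟨z₁, hz₁x, hz₁⟩ := hlo
  obtain ⟨z₂, hz₂x, hz₂⟩ := hhi
  have hb1 : BddAbove ({z | e z = z} ∩ Iic x) := ⟨x, fun z hz => hz.2⟩
  have hb2 : BddBelow ({z | e z = z} ∩ Ici x) := ⟨x, fun z hz => hz.2⟩
  have h1 := (hcl.inter isClosed_Iic).csSup_mem ⟨z₁, hz₁, hz₁x⟩ hb1
  have h2 := (hcl.inter isClosed_Ici).csInf_mem ⟨z₂, hz₂, hz₂x⟩ hb2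
  set u := sSup ({z | e z = z} ∩ Iic x)
  set w := sInf ({z | e z = z} ∩ Ici x)
  have hux : u < x := lt_of_le_of_ne h1.2 (by rintro h; exact hx (h ▸ h1.1))
  have hxw : x < w := lt_of_le_of_ne h2.2 (by rintro h; exact hx (h ▸ h2.1))
  refine ⟨u, w, ⟨h1.1, h2.1, hux.trans hxw, fun z hz hez => ?_⟩, hux, hxw⟩
  rcases le_total z x with h | h
  · exact absurd (le_csSup hb1 ⟨hez, h⟩) (not_le.2 hz.1)
  · exact absurd (csInf_le hb2 ⟨hez, h⟩) (not_le.2 hz.2)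

theorem ConsecFixed.unique {e : ℝ → ℝ} {u w u' w' x : ℝ} (h : ConsecFixed e u w)
    (h' : ConsecFixed e u' w') (hx : x ∈ Ioo u w) (hx' : x ∈ Ioo u' w') : u = u' ∧ w = w' := by
  constructor
  · rcases lt_trichotomy u u' with hlt | heq | hlt
    · exact absurd h'.1 (h.2.2.2 _ ⟨hlt, hx'.1.trans hx.2⟩)
    · exact heq
    · exact absurd h.1 (h'.2.2.2 _ ⟨hlt, hx.1.trans hx'.2⟩)
  · rcases lt_trichotomy w w' with hlt | heq | hlt
    · exact absurd h.2.1 (h'.2.2.2 _ ⟨hx'.1.trans hx.2, hlt⟩)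
    · exact heq
    · exact absurd h'.2.1 (h.2.2.2 _ ⟨hx.1.trans hx'.2, hlt⟩)

/-- Decreasing conjugacies between dual gaps glue to a decreasing conjugacy between the two half
lines determined by the central fixed point. -/
theorem exists_halfLine_conj {e : ℝ ≃o ℝ} {ω : ℝ → ℝ} {ξ : ℝ} {Ψ : ℝ → ℝ → ℝ → ℝ}
    (hω : MapsTo ω {x | e x = x} {x | e x = x}) (hanti : StrictAntiOn ω {x | e x = x})
    (hsurj : SurjOn ω {x | e x = x} {x | e x = x}) (hξ : e ξ = ξ) (hωξ : ω ξ = ξ)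
    (hlo : ∀ x, ∃ z ≤ x, e z = z) (hhi : ∀ x, ∃ z, x ≤ z ∧ e z = z)
    (hΨ : ∀ u w, ConsecFixed e u w → w ≤ ξ → GapConj e u w (ω w) (ω u) (Ψ u w)) :
    ∃ ψ : ℝ → ℝ, StrictAntiOn ψ (Iic ξ) ∧ ψ '' Iic ξ = Ici ξ ∧ (∀ x ≤ ξ, ψ (e x) = e (ψ x)) ∧
      ∀ u w, ConsecFixed e u w → w ≤ ξ → EqOn ψ (Ψ u w) (Ioo u w) := by
  classical
  have hgap : ∀ x, e x ≠ x → ∃ u w, ConsecFixed e u w ∧ x ∈ Ioo u w := fun x hx =>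
    exists_consecFixed e.continuous hx (hlo x) (hhi x)
  choose! lo hi hcons hmem using hgap
  obtain ⟨ψ, hψ⟩ : ∃ ψ : ℝ → ℝ, ψ = fun x => if e x = x then ω x else Ψ (lo x) (hi x) x :=
    ⟨_, rfl⟩
  have hψfix : ∀ x, e x = x → ψ x = ω x := fun x hx => by simp [hψ, hx]
  have hψgap : ∀ u w, ConsecFixed e u w → w ≤ ξ → EqOn ψ (Ψ u w) (Ioo u w) := by
    intro u w huw _ x hx
    have hex := huw.2.2.2 x hx
    obtain ⟨h1, h2⟩ := (hcons x hex).unique huw (hmem x hex) hx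
    simp [hψ, hex, h1, h2]
  have hhiξ : ∀ x ≤ ξ, e x ≠ x → hi x ≤ ξ := by
    intro x hxξ hx
    by_contra! h
    exact (hcons x hx).2.2.2 ξ ⟨(hmem x hx).1.trans_le hxξ, h⟩ hξ
  have hval : ∀ x ≤ ξ, e x ≠ x → ψ x ∈ Ioo (ω (hi x)) (ω (lo x)) := by
    intro x hxξ hx
    have hG := hΨ _ _ (hcons x hx) (hhiξ x hxξ hx)
    rw [hψgap _ _ (hcons x hx) (hhiξ x hxξ hx) (hmem x hx), ← hG.2.1]
    exact mem_image_of_mem _ (hmem x hx)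
  have habove : ∀ x z, x < z → z ≤ ξ → e z = z → ω z < ψ x := by
    intro x z hxz hzξ hz
    by_cases hx : e x = x
    · rw [hψfix x hx]
      exact hanti hx hz hxz
    · have hle : hi x ≤ z := by
        by_contra! h
        exact (hcons x hx).2.2.2 z ⟨(hmem x hx).1.trans hxz, h⟩ hz
      exact (hanti.antitoneOn (hcons x hx).2.1 hz hle).trans_lt (hval x (hxz.le.trans hzξ) hx).1
  have hbelow : ∀ y z, z < y → y ≤ ξ → e z = z → ψ y < ω z := by
    intro y z hzy hyξ hz
    by_cases hy : e y = y
    · rw [hψfix y hy]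
      exact hanti hz hy hzy
    · have hle : z ≤ lo y := by
        by_contra! h
        exact (hcons y hy).2.2.2 z ⟨h, hzy.trans (hmem y hy).2⟩ hz
      exact (hval y hyξ hy).2.trans_le (hanti.antitoneOn hz (hcons y hy).1 hle)
  have hψanti : StrictAntiOn ψ (Iic ξ) := by
    intro x hx y hy hxy
    by_cases hz : ∃ z ∈ Icc x y, e z = z
    · obtain ⟨z, hz, hez⟩ := hz
      have hzξ : z ≤ ξ := hz.2.trans hy
      rcases hz.1.eq_or_lt with rfl | h1
      · rw [hψfix x hez]
        exact hbelow y x hxy hy hez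
      · have h3 := habove x z h1 hzξ hez
        rcases hz.2.eq_or_lt with rfl | h2
        · rwa [hψfix z hez]
        · exact (hbelow y z h2 hy hez).trans h3
    · push Not at hz
      have hex := hz x ⟨le_rfl, hxy.le⟩
      have hymem : y ∈ Ioo (lo x) (hi x) := by
        refine ⟨(hmem x hex).1.trans hxy, ?_⟩
        by_contra! h
        exact hz _ ⟨(hmem x hex).2.le, h⟩ (hcons x hex).2.1
      have hEq := hψgap _ _ (hcons x hex) (hhiξ x hx hex)
      rw [hEq (hmem x hex), hEq hymem]
      exact (hΨ _ _ (hcons x hex) (hhiξ x hx hex)).1 (hmem x hex) hymem hxy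
  refine ⟨ψ, hψanti, Subset.antisymm ?_ ?_, ?_, hψgap⟩
  · rintro _ ⟨x, hx, rfl⟩
    rw [mem_Ici, ← hωξ, ← hψfix ξ hξ]
    exact hψanti.antitoneOn hx self_mem_Iic hx
  · intro y hy
    have hleft : ∀ z, e z = z → ξ ≤ ω z → z ≤ ξ := by
      intro z hz h
      by_contra! h'
      have := hanti hξ hz h'
      rw [hωξ] at this
      linarith
    by_cases hey : e y = y
    · obtain ⟨x, hx, rfl⟩ := hsurj hey
      exact ⟨x, hleft x hx hy, hψfix x hx⟩
    · have hC := hcons y hey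
      have hM := hmem y hey
      have hloξ : ξ ≤ lo y := by
        by_contra! h
        refine hC.2.2.2 ξ ⟨h, lt_of_le_of_lt hy hM.2⟩ hξ
      obtain ⟨w, hw, hωw⟩ := hsurj hC.1
      obtain ⟨u, hu, hωu⟩ := hsurj hC.2.1
      have hwξ := hleft w hw (hωw ▸ hloξ)
      have huw : u < w := (hanti.lt_iff_gt hw hu).1 (by rw [hωw, hωu]; exact hC.2.2.1)
      have hCuw : ConsecFixed e u w := by
        refine ⟨hu, hw, huw, fun z hz hez => hC.2.2.2 (ω z) ⟨?_, ?_⟩ (hω hez)⟩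
        · rw [← hωw]
          exact hanti hez hw hz.2
        · rw [← hωu]
          exact hanti hu hez hz.1
      have hG := hΨ _ _ hCuw hwξ
      have : y ∈ Ψ u w '' Ioo u w := by
        rw [hG.2.1, hωw, hωu]
        exact hM
      obtain ⟨x, hx, rfl⟩ := this
      exact ⟨x, hx.2.le.trans hwξ, hψgap _ _ hCuw hwξ hx⟩
  · intro x hx
    by_cases hex : e x = x
    · rw [hex, hψfix x hex, hω hex]
    · have hC := hcons x hex
      have hM := hmem x hex
      have hhi' := hhiξ x hx hex
      have heM : e x ∈ Ioo (lo x) (hi x) :=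
        ⟨by simpa [hC.1] using e.lt_iff_lt.2 hM.1, by simpa [hC.2.1] using e.lt_iff_lt.2 hM.2⟩
      rw [hψgap _ _ hC hhi' heM, hψgap _ _ hC hhi' hM]
      exact (hΨ _ _ hC hhi').2.2 x hM

/-- A decreasing conjugacy between the two half lines yields a decreasing square root. -/
theorem exists_strictAnti_sqrt {e : ℝ ≃o ℝ} {ξ : ℝ} {ψ : ℝ → ℝ} (hξ : e ξ = ξ)
    (hanti : StrictAntiOn ψ (Iic ξ)) (himg : ψ '' Iic ξ = Ici ξ)
    (hcomm : ∀ x ≤ ξ, ψ (e x) = e (ψ x)) :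
    ∃ g : ℝ → ℝ, StrictAnti g ∧ (∀ x, g (g x) = e x) ∧ EqOn g ψ (Iic ξ) := by
  have hinv : ∀ y, ξ ≤ y → ∃ x ≤ ξ, ψ x = y := fun y hy => by
    have : y ∈ ψ '' Iic ξ := by rw [himg]; exact hy
    exact this
  choose! θ hθξ hθ using hinv
  have hψξ : ∀ x ≤ ξ, ξ ≤ ψ x := fun x hx => by
    have : ψ x ∈ ψ '' Iic ξ := mem_image_of_mem _ hx
    rwa [himg] at this
  have hθψ : ∀ x ≤ ξ, θ (ψ x) = x := fun x hx =>
    hanti.injOn (hθξ _ (hψξ x hx)) hx (hθ _ (hψξ x hx))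
  have hfix : ψ ξ = ξ := le_antisymm
    ((hanti.antitoneOn (hθξ ξ le_rfl) self_mem_Iic (hθξ ξ le_rfl)).trans_eq (hθ ξ le_rfl))
    (hψξ ξ le_rfl)
  have hθlt : ∀ y, ξ < y → θ y < ξ := by
    intro y hy
    refine lt_of_le_of_ne (hθξ y hy.le) fun h => ?_
    have := hθ y hy.le
    rw [h, hfix] at this
    exact hy.ne this
  have heξ : ∀ x, x < ξ → e x < ξ := fun x hx => by simpa [hξ] using e.lt_iff_lt.2 hx
  refine ⟨fun x => if x ≤ ξ then ψ x else e (θ x), ?_, ?_, ?_⟩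
  · intro x y hxy
    by_cases hy : y ≤ ξ
    · simp only [hy, hxy.le.trans hy, if_true]
      exact hanti (hxy.le.trans hy) hy hxy
    · by_cases hx : x ≤ ξ
      · simp only [hx, hy, if_true, if_false]
        exact (heξ _ (hθlt y (not_le.1 hy))).trans_le (hψξ x hx)
      · simp only [hx, hy, if_false]
        push Not at hx hy
        refine e.lt_iff_lt.2 ((hanti.lt_iff_gt (hθξ x hx.le) (hθξ y hy.le)).1 ?_)
        rwa [hθ x hx.le, hθ y hy.le]
  · intro x
    rcases lt_trichotomy x ξ with hx | rfl | hx
    · have h1 : ξ < ψ x := by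
        rw [← hfix]
        exact hanti hx.le self_mem_Iic hx
      simp only [hx.le, not_le.2 h1, if_true, if_false, hθψ x hx.le]
    · simp [hfix, hξ]
    · have h1 := hθlt x hx
      simp only [not_le.2 hx, if_false, (heξ _ h1).le, if_true, hcomm _ h1.le, hθ x hx.le]
  · intro x hx
    simp only [mem_Iic] at hx
    simp [hx]

theorem ConsecFixed.lt_apply {e : ℝ → ℝ} (he : Continuous e) {u w x₀ : ℝ} (h : ConsecFixed e u w)
    (hx₀ : x₀ ∈ Ioo u w) (hup : x₀ < e x₀) : ∀ x ∈ Ioo u w, x < e x := by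
  intro x hx
  by_contra! hle
  obtain ⟨z, hz, hez⟩ := intermediate_value_uIcc (f := fun x => e x - x) (a := x₀) (b := x)
    (by fun_prop) (mem_uIcc.2 (.inr ⟨sub_nonpos.2 hle, (sub_pos.2 hup).le⟩))
  exact h.2.2.2 z (ordConnected_Ioo.uIcc_subset hx₀ hx hz) (sub_eq_zero.1 hez)

theorem ConsecFixed.apply_lt {e : ℝ → ℝ} (he : Continuous e) {u w x₀ : ℝ} (h : ConsecFixed e u w)
    (hx₀ : x₀ ∈ Ioo u w) (hdown : e x₀ < x₀) : ∀ x ∈ Ioo u w, e x < x := by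
  intro x hx
  by_contra! hle
  obtain ⟨z, hz, hez⟩ := intermediate_value_uIcc (f := fun x => e x - x) (a := x₀) (b := x)
    (by fun_prop) (mem_uIcc.2 (.inl ⟨(sub_neg.2 hdown).le, sub_nonneg.2 hle⟩))
  exact h.2.2.2 z (ordConnected_Ioo.uIcc_subset hx₀ hx hz) (sub_eq_zero.1 hez)

theorem ConsecFixed.dual {e ω : ℝ → ℝ} {u w : ℝ}
    (hω : MapsTo ω {x | e x = x} {x | e x = x}) (hanti : StrictAntiOn ω {x | e x = x})
    (hsurj : SurjOn ω {x | e x = x} {x | e x = x}) (h : ConsecFixed e u w) :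
    ConsecFixed e (ω w) (ω u) := by
  refine ⟨hω h.2.1, hω h.1, hanti h.1 h.2.1 h.2.2.1, fun z hz hez => ?_⟩
  obtain ⟨y, hy, rfl⟩ := hsurj hez
  exact h.2.2.2 y ⟨(hanti.lt_iff_gt hy h.1).1 hz.2, (hanti.lt_iff_gt h.2.1 hy).1 hz.1⟩ hy

/-- A reversing-correspondence function without fixed endpoints has a decreasing square root with
prescribed endpoint values. -/
theorem RevCorr.exists_strictAnti_root {F : ℝ → ℝ} {α β p q : ℝ} (hαβ : α < β)
    (hrev : RevCorr α β F) (hFα : α < F α) (hFβ : F β < β)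
    (hpq : (α < p ∧ p < F α ∧ F β < q ∧ q < β) ∨ (p = α ∧ q = F β) ∨ (p = F α ∧ q = β)) :
    ∃ g : ℝ → ℝ, StrictAnti g ∧ Surjective g ∧ g α = q ∧ g β = p ∧
      ∀ x ∈ Icc α β, g (g x) = F x := by
  classical
  obtain ⟨hFm, hFc, -, ξ, hξ, ω, hω, hωanti, hωsurj, hωξ, -, hsign⟩ := hrev
  obtain ⟨e, hemid, heleft, heright⟩ := exists_orderIso_extension hαβ.le hFc hFm
    (sub_nonneg.2 hFα.le) (sub_nonneg.2 hFβ.le)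
  obtain ⟨A, hA⟩ : ∃ A, A = α - (F α - α) := ⟨_, rfl⟩
  obtain ⟨B, hB⟩ : ∃ B, B = β + (β - F β) := ⟨_, rfl⟩
  have hAα : A < α := by linarith
  have hβB : β < B := by linarith
  have heA : ∀ x ≤ A, e x = x := fun x hx => by
    rw [heleft x (by linarith), max_eq_left (by linarith)]
    ring
  have heB : ∀ x, B ≤ x → e x = x := fun x hx => by
    rw [heright x (by linarith), min_eq_left (by linarith)]
    ring
  have heα : e α = F α := hemid α ⟨le_rfl, hαβ.le⟩
  have heβ : e β = F β := hemid β ⟨hαβ.le, le_rfl⟩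
  have heFix : ∀ x ∈ fixedSet α β F, e x = x := fun x hx => by rw [hemid x hx.1, hx.2]
  have hFixlt : ∀ x ∈ fixedSet α β F, α < x ∧ x < β := by
    rintro x ⟨⟨h1, h2⟩, h3⟩
    refine ⟨lt_of_le_of_ne h1 ?_, lt_of_le_of_ne h2 ?_⟩ <;> rintro rfl <;> linarith
  have hcases : ∀ x, e x = x → x ≤ A ∨ B ≤ x ∨ x ∈ fixedSet α β F := by
    intro x hx
    by_contra! h
    obtain ⟨h1, h2, h3⟩ := h
    rcases lt_or_ge x α with h4 | h4
    · rw [heleft x h4.le] at hx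
      linarith [le_max_right (-(F α - α)) (x - α)]
    · rcases lt_or_ge β x with h5 | h5
      · rw [heright x h5.le] at hx
        linarith [min_le_right (β - F β) (x - β)]
      · exact h3 ⟨⟨h4, h5⟩, by rw [← hemid x ⟨h4, h5⟩, hx]⟩
  obtain ⟨Ω, hΩ⟩ : ∃ Ω : ℝ → ℝ, Ω = fun x => if x ≤ A ∨ B ≤ x then A + B - x else ω x := ⟨_, rfl⟩
  have hΩout : ∀ x, x ≤ A ∨ B ≤ x → Ω x = A + B - x := fun x hx => by simp only [hΩ, hx, if_true]
  have hΩfix : ∀ x ∈ fixedSet α β F, Ω x = ω x := fun x hx => by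
    have h1 : ¬ x ≤ A := not_le.2 (hAα.trans (hFixlt x hx).1)
    have h2 : ¬ B ≤ x := not_le.2 ((hFixlt x hx).2.trans hβB)
    simp only [hΩ, h1, h2, or_self, if_false]
  have hΩmaps : MapsTo Ω {x | e x = x} {x | e x = x} := by
    intro x hx
    rcases hcases x hx with h | h | h
    · rw [hΩout x (.inl h)]
      exact heB _ (by linarith)
    · rw [hΩout x (.inr h)]
      exact heA _ (by linarith)
    · rw [hΩfix x h]
      exact heFix _ (hω h)
  have hΩanti : StrictAntiOn Ω {x | e x = x} := by
    intro x hx y hy hxy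
    rcases hcases x hx with h | h | h <;> rcases hcases y hy with h' | h' | h'
    · rw [hΩout x (.inl h), hΩout y (.inl h')]; linarith
    · rw [hΩout x (.inl h), hΩout y (.inr h')]; linarith
    · rw [hΩout x (.inl h), hΩfix y h']; linarith [(hFixlt _ (hω h')).2]
    · linarith
    · rw [hΩout x (.inr h), hΩout y (.inr h')]; linarith
    · linarith [(hFixlt _ h').2]
    · linarith [(hFixlt _ h).1]
    · rw [hΩfix x h, hΩout y (.inr h')]; linarith [(hFixlt _ (hω h)).1]
    · rw [hΩfix x h, hΩfix y h']
      exact hωanti h h' hxy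
  have hΩsurj : SurjOn Ω {x | e x = x} {x | e x = x} := by
    intro y hy
    rcases hcases y hy with h | h | h
    · exact ⟨A + B - y, heB _ (by linarith), by rw [hΩout _ (.inr (by linarith))]; ring⟩
    · exact ⟨A + B - y, heA _ (by linarith), by rw [hΩout _ (.inl (by linarith))]; ring⟩
    · obtain ⟨x, hx, rfl⟩ := hωsurj h
      exact ⟨x, heFix x hx, hΩfix x hx⟩
  have hξlt := hFixlt ξ hξ
  have hgap : ∀ u w, ConsecFixed e u w → w ≤ ξ →
      ∃ ψ, GapConj e u w (Ω w) (Ω u) ψ ∧ (u = A → ψ α = q ∧ ψ p = e β) := by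
    intro u w huw hwξ
    have hdual := huw.dual hΩmaps hΩanti hΩsurj
    have hw : w ∈ fixedSet α β F := by
      rcases hcases w huw.2.1 with h | h | h
      · obtain ⟨z, hz⟩ := exists_between huw.2.2.1
        exact absurd (heA z (hz.2.le.trans h)) (huw.2.2.2 z hz)
      · linarith
      · exact h
    rcases hcases u huw.1 with h | h | h
    · have huA : u = A := by
        by_contra hne
        exact huw.2.2.2 A ⟨lt_of_le_of_ne h hne, hAα.trans (hFixlt w hw).1⟩ (heA A le_rfl)
      subst huA
      have hαmem : α ∈ Ioo u w := ⟨hAα, (hFixlt w hw).1⟩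
      have hβmem : β ∈ Ioo (Ω w) (Ω u) := by
        rw [hΩfix w hw, hΩout u (.inl h)]
        exact ⟨(hFixlt _ (hω hw)).2, by linarith⟩
      obtain ⟨ψ, hψ, h1⟩ := exists_gapConj_marked (p := p) (q := q) huw.1 huw.2.1 hdual.1 hdual.2.1
        (huw.lt_apply e.continuous hαmem (by rwa [heα]))
        (hdual.apply_lt e.continuous hβmem (by rwa [heβ])) hαmem hβmem (by rwa [heα, heβ])
      exact ⟨ψ, hψ, fun _ => h1⟩
    · linarith [huw.2.2.1]
    · obtain ⟨x, hx⟩ := exists_between huw.2.2.1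
      obtain ⟨y, hy⟩ := exists_between hdual.2.2.1
      have hmul := hsign u h w hw huw.2.2.1 hwξ
        (fun z hz hz' => huw.2.2.2 z hz (heFix z hz')) x hx y
        (by rwa [← hΩfix u h, ← hΩfix w hw])
      rw [← hemid x ⟨h.1.1.trans hx.1.le, hx.2.le.trans hw.1.2⟩, ← hemid y
        ⟨(hFixlt _ (hω hw)).1.le.trans (by rw [← hΩfix w hw]; exact hy.1.le),
          le_trans (by rw [← hΩfix u h]; exact hy.2.le) (hFixlt _ (hω h)).2.le⟩] at hmul
      obtain ⟨ψ, hψ⟩ := exists_gapConj huw.1 huw.2.1 hdual.1 hdual.2.1 huw.2.2.1 hdual.2.2.1 (by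
        rcases mul_neg_iff.1 hmul with ⟨h1, h2⟩ | ⟨h1, h2⟩
        · exact .inl ⟨huw.lt_apply e.continuous hx (by linarith),
            hdual.apply_lt e.continuous hy (by linarith)⟩
        · exact .inr ⟨huw.apply_lt e.continuous hx (by linarith),
            hdual.lt_apply e.continuous hy (by linarith)⟩)
      exact ⟨ψ, hψ, fun huA => by linarith [(hFixlt u h).1]⟩
  choose! Ψ hΨ hΨmark using hgap
  obtain ⟨ψ, hψanti, hψimg, hψcomm, hψΨ⟩ := exists_halfLine_conj hΩmaps hΩanti hΩsurj
    (heFix ξ hξ) (by rw [hΩfix ξ hξ, hωξ])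
    (fun x => ⟨min x A, min_le_left _ _, heA _ (min_le_right _ _)⟩)
    (fun x => ⟨max x B, le_max_left _ _, heB _ (le_max_right _ _)⟩) hΨ
  obtain ⟨g, hg, hgg, hgψ⟩ := exists_strictAnti_sqrt (heFix ξ hξ) hψanti hψimg hψcomm
  obtain ⟨u, w, huw, hαmem⟩ := exists_consecFixed e.continuous (x := α) (by rw [heα]; exact hFα.ne')
    ⟨A, hAα.le, heA A le_rfl⟩ ⟨ξ, hξlt.1.le, heFix ξ hξ⟩
  have hwξ : w ≤ ξ := by
    by_contra! h
    exact huw.2.2.2 ξ ⟨hαmem.1.trans hξlt.1, h⟩ (heFix ξ hξ)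
  have huA : u = A := by
    rcases hcases u huw.1 with h | h | h
    · by_contra hne
      exact huw.2.2.2 A ⟨lt_of_le_of_ne h hne, hAα.trans hαmem.2⟩ (heA A le_rfl)
    · linarith [hαmem.1]
    · linarith [hαmem.1, (hFixlt u h).1]
  have hpmem : p ∈ Ioo u w := by
    have h1 : F α < w := by
      rw [← heα, ← huw.2.1]
      exact e.lt_iff_lt.2 hαmem.2
    have := hαmem.1
    rcases hpq with h | h | h
    · exact ⟨by linarith, by linarith⟩
    · exact ⟨by linarith, by linarith [hαmem.2]⟩
    · exact ⟨by linarith, by linarith⟩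
  obtain ⟨h1, h2⟩ := hΨmark u w huw hwξ huA
  have hgα : g α = q := by
    rw [hgψ hξlt.1.le, hψΨ u w huw hwξ hαmem, h1]
  have hgp : g p = e β := by
    rw [hgψ (hpmem.2.le.trans hwξ), hψΨ u w huw hwξ hpmem, h2]
  refine ⟨g, hg, ?_, hgα, ?_, fun x hx => by rw [hgg, hemid x hx]⟩
  · exact Surjective.of_comp (f := g) (g := g) (by
      intro y
      obtain ⟨x, rfl⟩ := e.surjective y
      exact ⟨x, hgg x⟩)
  · apply hg.injective
    rw [hgp, hgg]

section Forts

variable {a b : ℝ} {f g F : ℝ → ℝ} {x : ℝ}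

theorem not_isFort_iff (hx : x ∈ Icc a b) : ¬ IsFort a b F x ↔
    ∃ ε : ℝ, 0 < ε ∧ (StrictMonoOn F (Icc a b ∩ Ioo (x - ε) (x + ε)) ∨
      StrictAntiOn F (Icc a b ∩ Ioo (x - ε) (x + ε))) := by
  simp only [IsFort, hx, true_and]
  push Not
  refine exists_congr fun ε => and_congr_right fun _ => ?_
  tauto

theorem IsFort.congr (h : EqOn f g (Icc a b)) (hf : IsFort a b f x) : IsFort a b g x :=
  ⟨hf.1, fun ε hε =>
    ⟨fun hm => (hf.2 ε hε).1 (hm.congr fun _ hy => (h hy.1).symm),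
      fun hm => (hf.2 ε hε).2 (hm.congr fun _ hy => (h hy.1).symm)⟩⟩

theorem nForts_congr (h : EqOn f g (Icc a b)) : nForts a b f = nForts a b g :=
  congrArg Set.ncard (Set.ext fun _ => ⟨IsFort.congr h, IsFort.congr h.symm⟩)

theorem not_isFort_of_mem_Ioo {d e : ℝ}
    (h : StrictMonoOn F (Icc d e) ∨ StrictAntiOn F (Icc d e)) (hx : x ∈ Ioo d e) :
    ¬ IsFort a b F x := by
  intro hF
  have hsub : Icc a b ∩ Ioo (x - min (x - d) (e - x)) (x + min (x - d) (e - x)) ⊆ Icc d e := by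
    rintro y ⟨-, hy1, hy2⟩
    have h1 := min_le_left (x - d) (e - x)
    have h2 := min_le_right (x - d) (e - x)
    exact ⟨by linarith, by linarith⟩
  have hε : 0 < min (x - d) (e - x) := lt_min (by linarith [hx.1]) (by linarith [hx.2])
  rcases h with h | h
  · exact (hF.2 _ hε).1 (h.mono hsub)
  · exact (hF.2 _ hε).2 (h.mono hsub)

theorem isFort_of_strictMonoOn_strictAntiOn {d e : ℝ} (had : a ≤ d) (hdx : d < x) (hxe : x < e)
    (heb : e ≤ b) (h₁ : StrictMonoOn F (Icc d x)) (h₂ : StrictAntiOn F (Icc x e)) :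
    IsFort a b F x := by
  refine ⟨⟨by linarith, by linarith⟩, fun ε hε => ⟨fun h => ?_, fun h => ?_⟩⟩
  · obtain ⟨y, hy1, hy2⟩ := exists_between (lt_min hxe (show x < x + ε by linarith))
    have hye := hy2.trans_le (min_le_left _ _)
    have hyε := hy2.trans_le (min_le_right _ _)
    exact lt_asymm (h ⟨⟨by linarith, by linarith⟩, ⟨by linarith, by linarith⟩⟩
      ⟨⟨by linarith, by linarith⟩, ⟨by linarith, by linarith⟩⟩ hy1)
      (h₂ ⟨le_rfl, hxe.le⟩ ⟨hy1.le, hye.le⟩ hy1)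
  · obtain ⟨y, hy2, hy1⟩ := exists_between (max_lt hdx (show x - ε < x by linarith))
    have hye := (le_max_left _ _).trans_lt hy2
    have hyε := (le_max_right _ _).trans_lt hy2
    exact lt_asymm (h ⟨⟨by linarith, by linarith⟩, ⟨by linarith, by linarith⟩⟩
      ⟨⟨by linarith, by linarith⟩, ⟨by linarith, by linarith⟩⟩ hy1)
      (h₁ ⟨hye.le, hy1.le⟩ ⟨hdx.le, le_rfl⟩ hy1)

/-- A fort of the inner factor of a composition is a fort of the composition. -/
theorem IsFort.comp_left (hf : ContinuousOn f (Icc a b)) (hx : IsFort a b f x) :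
    IsFort a b (g ∘ f) x := by
  by_contra hF
  obtain ⟨ε, hε, h⟩ := (not_isFort_iff hx.1).1 hF
  have hinj : InjOn (g ∘ f) (Icc a b ∩ Ioo (x - ε) (x + ε)) :=
    h.elim StrictMonoOn.injOn StrictAntiOn.injOn
  set J := Icc (max a (x - ε / 2)) (min b (x + ε / 2)) with hJ
  have hJsub : J ⊆ Icc a b ∩ Ioo (x - ε) (x + ε) := by
    rintro y ⟨hy1, hy2⟩
    rw [max_le_iff] at hy1
    rw [le_min_iff] at hy2
    exact ⟨⟨hy1.1, hy2.1⟩, by linarith [hy1.2], by linarith [hy2.2]⟩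
  have hle : max a (x - ε / 2) ≤ min b (x + ε / 2) := by
    obtain ⟨h1, h2⟩ := hx.1
    exact max_le (le_min (by linarith) (by linarith)) (le_min (by linarith) (by linarith))
  have hsub : Icc a b ∩ Ioo (x - ε / 2) (x + ε / 2) ⊆ J := fun y hy =>
    ⟨max_le hy.1.1 hy.2.1.le, le_min hy.1.2 hy.2.2.le⟩
  have hfinj : InjOn f J := fun y hy z hz hyz =>
    hinj (hJsub hy) (hJsub hz) (congrArg g hyz)
  rcases ContinuousOn.strictMonoOn_of_injOn_Icc' hle
    (hf.mono fun y hy => (hJsub hy).1) hfinj with h' | h'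
  · exact (hx.2 _ (half_pos hε)).1 (h'.mono hsub)
  · exact (hx.2 _ (half_pos hε)).2 (h'.mono hsub)

/-- Composing with a strictly decreasing outer factor does not change the forts. -/
theorem isFort_comp_iff_of_strictAntiOn {S : Set ℝ} (hg : StrictAntiOn g S)
    (hF : MapsTo F (Icc a b) S) : IsFort a b (g ∘ F) x ↔ IsFort a b F x := by
  have key : ∀ T ⊆ Icc a b, (StrictMonoOn (g ∘ F) T ↔ StrictAntiOn F T) ∧
      (StrictAntiOn (g ∘ F) T ↔ StrictMonoOn F T) := by
    intro T hT
    have hlt : ∀ {y z}, y ∈ T → z ∈ T → ((g ∘ F) y < (g ∘ F) z ↔ F z < F y) :=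
      fun hy hz => hg.lt_iff_gt (hF (hT hy)) (hF (hT hz))
    exact ⟨⟨fun h y hy z hz hyz => (hlt hy hz).1 (h hy hz hyz),
        fun h y hy z hz hyz => (hlt hy hz).2 (h hy hz hyz)⟩,
      ⟨fun h y hy z hz hyz => (hlt hz hy).1 (h hy hz hyz),
        fun h y hy z hz hyz => (hlt hz hy).2 (h hy hz hyz)⟩⟩
  refine and_congr_right fun _ => forall₂_congr fun ε _ => ?_
  rw [(key _ inter_subset_left).1, (key _ inter_subset_left).2, and_comm]

theorem not_isFort_id : ¬ IsFort a b id x := fun h =>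
  (h.2 1 one_pos).1 (strictMono_id.strictMonoOn _)

theorem PMFun.exists_lap {v : ℕ} {c : ℕ → ℝ} (h : PMFun a b F v c) (hx : x ∈ Icc a b) :
    ∃ i ≤ v, x ∈ Icc (c i) (c (i + 1)) := by
  have key : ∀ n ≤ v, x ≤ c (n + 1) → ∃ i ≤ v, x ∈ Icc (c i) (c (i + 1)) := by
    intro n
    induction n with
    | zero => exact fun h0 hle => ⟨0, h0, by rw [h.c_zero]; exact hx.1, hle⟩
    | succ n ih =>
      intro hn hle
      rcases le_total x (c (n + 1)) with h' | h'
      · exact ih (by omega) h'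
      · exact ⟨n + 1, hn, h', hle⟩
  exact key v le_rfl (by rw [h.c_last]; exact hx.2)

theorem PMFun.finite_setOf_isFort {v : ℕ} {c : ℕ → ℝ} (h : PMFun a b F v c) :
    {x | IsFort a b F x}.Finite := by
  refine ((Set.finite_Iic (v + 1)).image c).subset fun x hx => ?_
  obtain ⟨i, hi, hxi⟩ := h.exists_lap hx.1
  rcases hxi.1.eq_or_lt with h1 | h1
  · exact ⟨i, by simp only [mem_Iic]; omega, h1⟩
  rcases hxi.2.eq_or_lt with h2 | h2
  · exact ⟨i + 1, by simp only [mem_Iic]; omega, h2.symm⟩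
  exact (not_isFort_of_mem_Ioo (h.lap_mono i hi) ⟨h1, h2⟩ hx).elim

/-- If `f` is a square root of `F`, decreasing on an interval that contains the range of `F`,
and `F` has strictly more forts than `f`, which has one, then `f` has height two. -/
theorem heightEq_two_of_sqrt {S : Set ℝ} {d e : ℝ} (hf : ContinuousOn f (Icc a b))
    (hsq : ∀ x ∈ Icc a b, f (f x) = F x) (hfin : {x | IsFort a b F x}.Finite)
    (hanti : StrictAntiOn f S) (hFS : MapsTo F (Icc a b) S)
    (hd : IsFort a b f d) (he : IsFort a b F e) (he' : ¬ IsFort a b f e) :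
    HeightEq a b f 2 := by
  have hsub : {x | IsFort a b f x} ⊆ {x | IsFort a b F x} := fun x hx =>
    (IsFort.comp_left (g := f) hf hx).congr hsq
  have h2 : nForts a b f^[2] = nForts a b F := nForts_congr hsq
  have h3 : nForts a b f^[3] = nForts a b F := by
    have : nForts a b f^[3] = nForts a b (f ∘ F) :=
      nForts_congr fun x hx => congrArg f (hsq x hx)
    rw [this]
    exact congrArg Set.ncard (Set.ext fun x => isFort_comp_iff_of_strictAntiOn hanti hFS)
  have hlt : nForts a b f < nForts a b F :=
    Set.ncard_lt_ncard (Set.ssubset_iff_of_subset hsub |>.2 ⟨e, he, he'⟩) hfin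
  have hpos : 0 < nForts a b f :=
    (Set.ncard_pos (hfin.subset hsub)).2 ⟨d, hd⟩
  have h0 : nForts a b id = 0 := by
    simp [nForts, not_isFort_id]
  refine ⟨h2.trans h3.symm, fun i hi => ?_⟩
  by_contra! hlt2
  interval_cases i
  · have : nForts a b id = nForts a b f := hi
    omega
  · have : nForts a b f = nForts a b f^[2] := hi
    omega

end Forts

theorem ContinuousOn.ite_le_Icc {f g : ℝ → ℝ} {a b c : ℝ}
    (hf : ContinuousOn f (Icc a b)) (hg : ContinuousOn g (Icc b c)) (hfg : f b = g b) :
    ContinuousOn (fun x => if x ≤ b then f x else g x) (Icc a c) := by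
  have h1 : ContinuousOn (fun x => if x ≤ b then f x else g x) (Icc a b) :=
    hf.congr fun x hx => if_pos hx.2
  have h2 : ContinuousOn (fun x => if x ≤ b then f x else g x) (Icc b c) := by
    refine hg.congr fun x hx => ?_
    rcases hx.1.eq_or_lt with h | h
    · subst h
      simp [hfg]
    · exact if_neg h.not_ge
  exact (h1.union_of_isClosed h2 isClosed_Icc isClosed_Icc).mono Icc_subset_Icc_union_Icc

/-- Gluing finitely many continuous pieces on adjacent intervals running to the right, each
of which satisfies a pointwise relation. -/
theorem exists_glue_right {y : ℕ → ℝ} {f : ℕ → ℝ → ℝ} {R : ℝ → ℝ → Prop} (n : ℕ)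
    (hy : ∀ j ≤ n, y j < y (j + 1))
    (hc : ∀ j ≤ n, ContinuousOn (f j) (Icc (y j) (y (j + 1))))
    (hR : ∀ j ≤ n, ∀ x ∈ Icc (y j) (y (j + 1)), R x (f j x))
    (hag : ∀ j < n, f j (y (j + 1)) = f (j + 1) (y (j + 1))) :
    ∃ G : ℝ → ℝ, ContinuousOn G (Icc (y 0) (y (n + 1))) ∧
      (∀ x ∈ Icc (y 0) (y (n + 1)), R x (G x)) ∧ G (y 0) = f 0 (y 0) := by
  suffices ∃ G : ℝ → ℝ, ContinuousOn G (Icc (y 0) (y (n + 1))) ∧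
      (∀ x ∈ Icc (y 0) (y (n + 1)), R x (G x)) ∧ G (y 0) = f 0 (y 0) ∧
      G (y (n + 1)) = f n (y (n + 1)) ∧ y 0 < y (n + 1) by
    obtain ⟨G, h1, h2, h3, -⟩ := this
    exact ⟨G, h1, h2, h3⟩
  induction n with
  | zero => exact ⟨f 0, hc 0 le_rfl, hR 0 le_rfl, rfl, rfl, hy 0 le_rfl⟩
  | succ n ih =>
    obtain ⟨G, h1, h2, h3, h4, h5⟩ := ih (fun j hj => hy j (by omega))
      (fun j hj => hc j (by omega)) (fun j hj => hR j (by omega)) (fun j hj => hag j (by omega))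
    have hlt := hy (n + 1) le_rfl
    refine ⟨fun x => if x ≤ y (n + 1) then G x else f (n + 1) x,
      h1.ite_le_Icc (hc (n + 1) le_rfl) (h4.trans (hag n (by omega))), fun x hx => ?_,
      (if_pos h5.le).trans h3, if_neg hlt.not_ge, h5.trans hlt⟩
    dsimp only
    split_ifs with h
    · exact h2 x ⟨hx.1, h⟩
    · exact hR (n + 1) le_rfl x ⟨(not_le.1 h).le, hx.2⟩

/-- Mirror image of `exists_glue_right`. -/
theorem exists_glue_left {y : ℕ → ℝ} {f : ℕ → ℝ → ℝ} {R : ℝ → ℝ → Prop} (n : ℕ)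
    (hy : ∀ j ≤ n, y (j + 1) < y j)
    (hc : ∀ j ≤ n, ContinuousOn (f j) (Icc (y (j + 1)) (y j)))
    (hR : ∀ j ≤ n, ∀ x ∈ Icc (y (j + 1)) (y j), R x (f j x))
    (hag : ∀ j < n, f j (y (j + 1)) = f (j + 1) (y (j + 1))) :
    ∃ G : ℝ → ℝ, ContinuousOn G (Icc (y (n + 1)) (y 0)) ∧
      (∀ x ∈ Icc (y (n + 1)) (y 0), R x (G x)) ∧ G (y 0) = f 0 (y 0) := by
  have hneg : ∀ {u w x : ℝ}, x ∈ Icc (-u) (-w) → -x ∈ Icc w u := fun hx =>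
    ⟨by linarith [hx.2], by linarith [hx.1]⟩
  obtain ⟨G, h1, h2, h3⟩ := exists_glue_right (y := fun j => -y j) (f := fun j x => f j (-x))
    (R := fun x z => R (-x) z) n (fun j hj => neg_lt_neg (hy j hj))
    (fun j hj => (hc j hj).comp continuous_neg.continuousOn fun x hx => hneg hx)
    (fun j hj x hx => hR j hj _ (hneg hx))
    (fun j hj => by simpa using hag j hj)
  refine ⟨fun x => G (-x), h1.comp continuous_neg.continuousOn fun x hx => ?_,
    fun x hx => ?_, by simpa using h3⟩
  · exact ⟨neg_le_neg hx.2, neg_le_neg hx.1⟩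
  · simpa using h2 (-x) ⟨neg_le_neg hx.2, neg_le_neg hx.1⟩

theorem StrictAnti.exists_inverse {g : ℝ → ℝ} (hg : StrictAnti g) (hs : Surjective g) :
    Continuous g ∧ ∃ h : ℝ → ℝ, StrictAnti h ∧ Continuous h ∧ (∀ x, g (h x) = x) ∧
      ∀ x, h (g x) = x := by
  have hcont : ∀ {u : ℝ → ℝ}, StrictAnti u → Surjective u → Continuous u := fun {u} hu hu' => by
    have : Continuous fun x => -u x := hu.neg.monotone.continuous_of_surjective
      (neg_surjective.comp hu')
    exact this.neg.congr fun x => neg_neg (u x)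
  have hgh := surjInv_eq hs
  have hhg : ∀ x, surjInv hs (g x) = x := fun x => hg.injective (hgh _)
  have hh : StrictAnti (surjInv hs) := fun x y hxy => hg.lt_iff_gt.1 (by rwa [hgh, hgh])
  exact ⟨hcont hg hs, surjInv hs, hh, hcont hh fun x => ⟨g x, hhg x⟩, hgh, hhg⟩

/-- A decreasing square root of `F` on `[α, β]` extends to the two neighbouring laps, and the
extension has continuous sections `H₀`, `H₁`, `H₂` with overlapping domains. -/
theorem exists_sqrt_extension {F g : ℝ → ℝ} {d α β e : ℝ} (hdα : d < α) (hαβ : α < β)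
    (hβe : β < e) (hcont : ContinuousOn F (Icc d e)) (hl : StrictAntiOn F (Icc d α))
    (hr : StrictAntiOn F (Icc β e)) (hg : StrictAnti g) (hs : Surjective g)
    (hgα : g α = F d) (hgβ : g β = F e) (hgg : ∀ x ∈ Icc α β, g (g x) = F x)
    (hα : α ≤ F e) (hβ : F d ≤ β) :
    ∃ f H₀ H₁ H₂ : ℝ → ℝ, ContinuousOn f (Icc d e) ∧ StrictMonoOn f (Icc d α) ∧
      StrictAntiOn f (Icc α β) ∧ f d = α ∧ f e = β ∧
      MapsTo f (Icc d e) (Icc d e) ∧ (∀ x ∈ Icc d e, f (f x) = F x) ∧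
      StrictMono H₀ ∧ Continuous H₀ ∧ Continuous H₁ ∧ Continuous H₂ ∧
      H₀ (F d) = α ∧ H₁ (F d) = α ∧ H₁ (F e) = β ∧ H₂ (F e) = β ∧
      (∀ y ∈ Icc α (F d), H₀ y ∈ Icc d e ∧ f (H₀ y) = y) ∧
      (∀ y ∈ Icc (F e) (F d), H₁ y ∈ Icc d e ∧ f (H₁ y) = y) ∧
      (∀ y ∈ Icc (F e) β, H₂ y ∈ Icc d e ∧ f (H₂ y) = y) := by
  obtain ⟨hgc, h, hh, hhc, hgh, hhg⟩ := hg.exists_inverse hs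
  have hhα : h (F α) = F d := by rw [← hgg α ⟨le_rfl, hαβ.le⟩, hhg, hgα]
  have hhβ : h (F β) = F e := by rw [← hgg β ⟨hαβ.le, le_rfl⟩, hhg, hgβ]
  have hhd : h (F d) = α := by rw [← hgα, hhg]
  have hhe : h (F e) = β := by rw [← hgβ, hhg]
  have hFed : F e < F d := by rw [← hgα, ← hgβ]; exact hg hαβ
  have hml : StrictMonoOn (h ∘ F) (Icc d α) := fun x hx y hy hxy => hh (hl hx hy hxy)
  have hmr : StrictMonoOn (h ∘ F) (Icc β e) := fun x hx y hy hxy => hh (hr hx hy hxy)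
  have hcl : ContinuousOn (h ∘ F) (Icc d α) :=
    hhc.comp_continuousOn (hcont.mono (Icc_subset_Icc le_rfl (hαβ.trans hβe).le))
  have hcr : ContinuousOn (h ∘ F) (Icc β e) :=
    hhc.comp_continuousOn (hcont.mono (Icc_subset_Icc (hdα.trans hαβ).le le_rfl))
  obtain ⟨E₀, hE₀, -, -⟩ := exists_orderIso_extension hdα.le hcl hml le_rfl le_rfl
  obtain ⟨E₂, hE₂, -, -⟩ := exists_orderIso_extension hβe.le hcr hmr le_rfl le_rfl
  have hE₀d : E₀ d = α := (hE₀ d ⟨le_rfl, hdα.le⟩).trans hhd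
  have hE₀α : E₀ α = F d := (hE₀ α ⟨hdα.le, le_rfl⟩).trans hhα
  have hE₂β : E₂ β = F e := (hE₂ β ⟨le_rfl, hβe.le⟩).trans hhβ
  have hE₂e : E₂ e = β := (hE₂ e ⟨hβe.le, le_rfl⟩).trans hhe
  set f : ℝ → ℝ := fun x => if x ≤ α then E₀ x else if x ≤ β then g x else E₂ x with hf
  have hf₀ : EqOn f E₀ (Icc d α) := fun x hx => if_pos hx.2
  have hf₁ : EqOn f g (Icc α β) := fun x hx => by
    rcases hx.1.eq_or_lt with h' | h'
    · subst h'
      simp [hf, hE₀α, hgα]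
    · simp [hf, h'.not_ge, hx.2]
  have hf₂ : EqOn f E₂ (Icc β e) := fun x hx => by
    rcases hx.1.eq_or_lt with h' | h'
    · subst h'
      simp [hf, hαβ.not_ge, hE₂β, hgβ]
    · simp [hf, h'.not_ge, (hαβ.trans h').not_ge]
  have hE₀mem : ∀ x ∈ Icc d α, E₀ x ∈ Icc α (F d) := fun x hx => by
    rw [← hE₀α]
    nth_rw 1 [← hE₀d]
    exact ⟨E₀.monotone hx.1, E₀.monotone hx.2⟩
  have hE₂mem : ∀ x ∈ Icc β e, E₂ x ∈ Icc (F e) β := fun x hx => by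
    rw [← hE₂β]
    nth_rw 2 [← hE₂e]
    exact ⟨E₂.monotone hx.1, E₂.monotone hx.2⟩
  have hgmem : ∀ x ∈ Icc α β, g x ∈ Icc (F e) (F d) := fun x hx => by
    rw [← hgα, ← hgβ]
    exact ⟨hg.antitone hx.2, hg.antitone hx.1⟩
  have hcases : ∀ x ∈ Icc d e, f x ∈ Icc α β ∧ g (f x) = F x := by
    intro x hx
    rcases le_total x α with h1 | h1
    · have hx' : x ∈ Icc d α := ⟨hx.1, h1⟩
      have := hE₀mem x hx'
      rw [hf₀ hx']
      exact ⟨⟨this.1, this.2.trans hβ⟩, by rw [hE₀ x hx']; exact hgh _⟩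
    rcases le_total x β with h2 | h2
    · have hx' : x ∈ Icc α β := ⟨h1, h2⟩
      have := hgmem x hx'
      rw [hf₁ hx']
      exact ⟨⟨hα.trans this.1, this.2.trans hβ⟩, hgg x hx'⟩
    · have hx' : x ∈ Icc β e := ⟨h2, hx.2⟩
      have := hE₂mem x hx'
      rw [hf₂ hx']
      exact ⟨⟨hα.trans this.1, this.2⟩, by rw [hE₂ x hx']; exact hgh _⟩
  have hsub : Icc α β ⊆ Icc d e := Icc_subset_Icc hdα.le hβe.le
  refine ⟨f, E₀.symm, h, E₂.symm, ?_, ?_, ?_, ?_, ?_, fun x hx => hsub (hcases x hx).1,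
    fun x hx => (hf₁ (hcases x hx).1).trans (hcases x hx).2, E₀.symm.strictMono,
    E₀.symm.continuous, hhc, E₂.symm.continuous, ?_, hhd, hhe, ?_, fun y hy => ?_,
    fun y hy => ?_, fun y hy => ?_⟩
  · refine ContinuousOn.ite_le_Icc (c := e) E₀.continuous.continuousOn
      (ContinuousOn.ite_le_Icc hgc.continuousOn E₂.continuous.continuousOn ?_) ?_
    · rw [hgβ, hE₂β]
    · simp [hαβ.le, hE₀α, hgα]
  · exact (E₀.strictMono.strictMonoOn _).congr hf₀.symm
  · exact (hg.strictAntiOn _).congr hf₁.symm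
  · rw [hf₀ ⟨le_rfl, hdα.le⟩, hE₀d]
  · rw [hf₂ ⟨hβe.le, le_rfl⟩, hE₂e]
  · rw [← hE₀α, E₀.symm_apply_apply]
  · rw [← hE₂β, E₂.symm_apply_apply]
  · have hmem : E₀.symm y ∈ Icc d α := by
      rw [← hE₀α] at hy
      nth_rw 1 [← hE₀d] at hy
      exact ⟨E₀.le_symm_apply.2 hy.1, E₀.symm_apply_le.2 hy.2⟩
    exact ⟨⟨hmem.1, hmem.2.trans (hαβ.trans hβe).le⟩,
      (hf₀ hmem).trans (E₀.apply_symm_apply y)⟩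
  · have hmem : h y ∈ Icc α β := by
      rw [← hhd, ← hhe]
      exact ⟨hh.antitone hy.2, hh.antitone hy.1⟩
    exact ⟨hsub hmem, (hf₁ hmem).trans (hgh y)⟩
  · have hmem : E₂.symm y ∈ Icc β e := by
      rw [← hE₂β] at hy
      nth_rw 2 [← hE₂e] at hy
      exact ⟨E₂.le_symm_apply.2 hy.1, E₂.symm_apply_le.2 hy.2⟩
    exact ⟨⟨(hdα.trans hαβ).le.trans hmem.1, hmem.2⟩,
      (hf₂ hmem).trans (E₂.apply_symm_apply y)⟩

theorem PMFun.strictMonoOn {a b : ℝ} {F : ℝ → ℝ} {v : ℕ} {c : ℕ → ℝ} (h : PMFun a b F v c) :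
    StrictMonoOn c (Iic (v + 1)) :=
  strictMonoOn_Iic_of_lt_succ fun i hi => h.c_mono i (Nat.le_of_lt_succ hi)

theorem PMFun.mem_Icc {a b : ℝ} {F : ℝ → ℝ} {v : ℕ} {c : ℕ → ℝ} (h : PMFun a b F v c) {i : ℕ}
    (hi : i ≤ v + 1) : c i ∈ Icc a b := by
  rw [← h.c_zero, ← h.c_last]
  exact ⟨h.strictMonoOn.monotoneOn (by simp) hi (Nat.zero_le i),
    h.strictMonoOn.monotoneOn hi (by simp) hi⟩

theorem PMFun.strictMonoOn_lap {a b : ℝ} {F : ℝ → ℝ} {v : ℕ} {c : ℕ → ℝ} (h : PMFun a b F v c)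
    {i : ℕ} (hi : i ≤ v) (hF : F (c i) ≤ F (c (i + 1))) :
    StrictMonoOn F (Icc (c i) (c (i + 1))) :=
  (h.lap_mono i hi).resolve_right fun h' =>
    (h' ⟨le_rfl, (h.c_mono i hi).le⟩ ⟨(h.c_mono i hi).le, le_rfl⟩ (h.c_mono i hi)).not_ge hF

theorem PMFun.strictAntiOn_lap {a b : ℝ} {F : ℝ → ℝ} {v : ℕ} {c : ℕ → ℝ} (h : PMFun a b F v c)
    {i : ℕ} (hi : i ≤ v) (hF : F (c (i + 1)) ≤ F (c i)) :
    StrictAntiOn F (Icc (c i) (c (i + 1))) :=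
  (h.lap_mono i hi).resolve_left fun h' =>
    (h' ⟨le_rfl, (h.c_mono i hi).le⟩ ⟨(h.c_mono i hi).le, le_rfl⟩ (h.c_mono i hi)).not_ge hF

/-- Theorem 2.4, middle-lap case, root decreasing on the
characteristic interval. -/
theorem stmt3 (a b : ℝ) (F : ℝ → ℝ) (v : ℕ) (c : ℕ → ℝ) (k : ℕ)
    (hPM : PMFun a b F v c) (hk1 : 1 ≤ k) (hkv : k + 1 ≤ v)
    (hK : Set.MapsTo F (Set.Icc a b) (Set.Icc (c k) (c (k + 1))))
    (hinc : StrictMonoOn F (Set.Icc (c k) (c (k + 1))))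
    (hK0fail :
      (∃ x ∈ Set.Icc a b, F x = c k ∧ F (c k) ≠ c k) ∨
      (∃ x ∈ Set.Icc a b, F x = c (k + 1) ∧ F (c (k + 1)) ≠ c (k + 1)))
    (hrev : RevCorr (c k) (c (k + 1)) F)
    (hcond :
      (c k = F (c (k + 2)) ∧ F (c (k + 2)) < F (c k) ∧ F (c k) < F (c (k + 1)) ∧
        F (c (k + 1)) = F (c (k - 1)) ∧ F (c (k - 1)) < c (k + 1)) ∨
      (c k < F (c (k + 2)) ∧ F (c (k + 2)) < F (c k) ∧ F (c k) < F (c (k + 1)) ∧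
        F (c (k + 1)) < F (c (k - 1)) ∧ F (c (k - 1)) < c (k + 1)) ∨
      (c k < F (c (k + 2)) ∧ F (c (k + 2)) = F (c k) ∧ F (c k) < F (c (k + 1)) ∧
        F (c (k + 1)) < F (c (k - 1)) ∧ F (c (k - 1)) = c (k + 1)))
    (s : ℕ) (l : ℕ → ℕ)
    (hl0 : l 0 = k - 1) (hlLast : l (s + 1) = 0)
    (hlDec : ∀ j ≤ s, l (j + 1) < l j)
    (hlVal01 : ∀ j ≤ s, j % 4 = 0 ∨ j % 4 = 1 → F (c (l j)) = F (c (k - 1)))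
    (hlVal23 : ∀ j ≤ s, j % 4 = 2 ∨ j % 4 = 3 → F (c (l j)) = F (c (k + 2)))
    (hlMax : ∀ j ≤ s, j % 4 = 0 ∨ j % 4 = 1 ∨ j % 4 = 3 →
      IsGreatest (F '' Set.Icc (c (l (j + 1))) (c (l j))) (F (c (k - 1))))
    (hlMin : ∀ j ≤ s, j % 4 = 1 ∨ j % 4 = 2 ∨ j % 4 = 3 →
      IsLeast (F '' Set.Icc (c (l (j + 1))) (c (l j))) (F (c (k + 2))))
    (t : ℕ) (r : ℕ → ℕ)
    (hr0 : r 0 = k + 2) (hrLast : r (t + 1) = v + 1)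
    (hrInc : ∀ j ≤ t, r j < r (j + 1))
    (hrVal01 : ∀ j ≤ t, j % 4 = 0 ∨ j % 4 = 1 → F (c (r j)) = F (c (k + 2)))
    (hrVal23 : ∀ j ≤ t, j % 4 = 2 ∨ j % 4 = 3 → F (c (r j)) = F (c (k - 1)))
    (hrMin : ∀ j ≤ t, j % 4 = 0 ∨ j % 4 = 1 ∨ j % 4 = 3 →
      IsLeast (F '' Set.Icc (c (r j)) (c (r (j + 1)))) (F (c (k + 2))))
    (hrMax : ∀ j ≤ t, j % 4 = 1 ∨ j % 4 = 2 ∨ j % 4 = 3 →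
      IsGreatest (F '' Set.Icc (c (r j)) (c (r (j + 1)))) (F (c (k - 1)))) :
    ∃ f : ℝ → ℝ, ContinuousOn f (Set.Icc a b) ∧
      Set.MapsTo f (Set.Icc a b) (Set.Icc a b) ∧
      (∀ x ∈ Set.Icc a b, f (f x) = F x) ∧
      StrictAntiOn f (Set.Icc (c k) (c (k + 1))) ∧
      HeightEq a b f 2 := by
  obtain ⟨m, rfl⟩ : ∃ m, k = m + 2 := ⟨k - 2, by have := hlDec 0 s.zero_le; omega⟩
  simp only [show m + 2 - 1 = m + 1 by omega, show m + 2 + 1 = m + 3 by omega,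
    show m + 2 + 2 = m + 4 by omega] at *
  have hmono := hPM.strictMonoOn
  have hlev : ∀ j ≤ s + 1, l j ≤ m + 1 := by
    intro j
    induction j with
    | zero => exact fun _ => hl0.le
    | succ j ih => exact fun hj => (hlDec j (by omega)).le.trans (ih (by omega))
  have hrv : ∀ j ≤ t + 1, r j ≤ v + 1 := fun j hj =>
    ((strictMonoOn_Iic_of_lt_succ fun i hi => hrInc i (Nat.le_of_lt_succ hi)).monotoneOn hj
      (mem_Iic.2 le_rfl) hj).trans hrLast.le
  have hdα := hPM.c_mono (m + 1) (by omega)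
  have hαβ := hPM.c_mono (m + 2) (by omega)
  have hβe := hPM.c_mono (m + 3) (by omega)
  set d := c (m + 1) with hd
  set α := c (m + 2) with hα
  set β := c (m + 3) with hβ
  set e := c (m + 4) with he
  have hda : d ∈ Icc a b := hPM.mem_Icc (by omega)
  have hea : e ∈ Icc a b := hPM.mem_Icc (by omega)
  have hM : Icc d e ⊆ Icc a b := Icc_subset_Icc hda.1 hea.2
  have hpq : (α < F e ∧ F e < F α ∧ F β < F d ∧ F d < β) ∨ (F e = α ∧ F d = F β) ∨
      (F e = F α ∧ F d = β) := by
    rcases hcond with h | h | h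
    · exact .inr (.inl ⟨h.1.symm, h.2.2.2.1.symm⟩)
    · exact .inl ⟨h.1, h.2.1, h.2.2.2.1, h.2.2.2.2⟩
    · exact .inr (.inr ⟨h.2.1, h.2.2.2.2⟩)
  have hFe : α ≤ F e ∧ F e ≤ F α ∧ F β ≤ F d ∧ F d ≤ β ∧ F α < F β ∧ α < F α ∧ F β < β := by
    rcases hcond with ⟨h1, h2, h3, h4, h5⟩ | ⟨h1, h2, h3, h4, h5⟩ | ⟨h1, h2, h3, h4, h5⟩ <;>
      refine ⟨?_, ?_, ?_, ?_, ?_, ?_, ?_⟩ <;> linarith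
  obtain ⟨hαp, hpα, hβq, hqβ, hlt, hFα, hFβ⟩ := hFe
  obtain ⟨g, hg, hgs, hgα, hgβ, hgg⟩ := hrev.exists_strictAnti_root hαβ hFα hFβ hpq
  obtain ⟨f, H₀, H₁, H₂, hfc, hfl, hfm, hfd, hfe, hfmaps, hff, hH₀, hH₀c, hH₁c, hH₂c, hH₀q, hH₁q,
      hH₁p, hH₂p, hsec₀, hsec₁, hsec₂⟩ :=
    exists_sqrt_extension hdα hαβ hβe (hPM.cont.mono hM)
      (hPM.strictAntiOn_lap (by omega) (hlt.le.trans hβq))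
      (hPM.strictAntiOn_lap (by omega) (hpα.trans hlt.le)) hg hgs hgα hgβ hgg hαp hqβ
  set H : ℕ → ℝ → ℝ := fun n => if n % 4 = 0 then H₀ else if n % 4 = 2 then H₂ else H₁ with hH
  have hHc : ∀ n, Continuous (H n) := fun n => by
    simp only [hH]
    split_ifs <;> assumption
  have hHsec : ∀ n y, y ∈ Icc α β → (n % 4 ≠ 2 → y ≤ F d) → (n % 4 ≠ 0 → F e ≤ y) →
      H n y ∈ Icc d e ∧ f (H n y) = y := by
    intro n y hy hyd hye
    simp only [hH]
    split_ifs with h1 h2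
    · exact hsec₀ y ⟨hy.1, hyd (by omega)⟩
    · exact hsec₂ y ⟨hye h1, hy.2⟩
    · exact hsec₁ y ⟨hye h1, hyd h2⟩
  have hagree : ∀ n y, ((n + 1) % 4 = 0 ∨ (n + 1) % 4 = 1 → y = F d) →
      ((n + 1) % 4 = 2 ∨ (n + 1) % 4 = 3 → y = F e) → H n y = H (n + 1) y := by
    intro n y h1 h2
    have h4 : (n + 1) % 4 = (n % 4 + 1) % 4 := by omega
    have hn : n % 4 = 0 ∨ n % 4 = 1 ∨ n % 4 = 2 ∨ n % 4 = 3 := by omega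
    rcases hn with hn | hn | hn | hn <;> simp only [hn, h4, hH] at h1 h2 ⊢ <;>
      norm_num at h1 h2 ⊢ <;>
      simp only [h1, h2, hH₀q, hH₁q, hH₁p, hH₂p]
  have hFI : ∀ x ∈ Icc a b, F x ∈ Icc α β := fun x hx => hK hx
  have hlI : ∀ j ≤ s, Icc (c (l (j + 1))) (c (l j)) ⊆ Icc a b := fun j hj =>
    Icc_subset_Icc (hPM.mem_Icc (by have := hlev (j + 1) (by omega); omega)).1
      (hPM.mem_Icc (by have := hlev j (by omega); omega)).2
  have hrI : ∀ j ≤ t, Icc (c (r j)) (c (r (j + 1))) ⊆ Icc a b := fun j hj =>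
    Icc_subset_Icc (hPM.mem_Icc (hrv j (by omega))).1 (hPM.mem_Icc (hrv (j + 1) (by omega))).2
  obtain ⟨L, hLc, hLR, hL0⟩ := exists_glue_left (y := fun j => c (l j))
    (f := fun j => H j ∘ F)
    (R := fun x y => (y ∈ Icc d e ∧ f y = F x) ∧ (c m < x → y = H₀ (F x))) s
    (fun j hj => hmono (by simp only [mem_Iic]; have := hlev (j + 1) (by omega); omega)
      (by simp only [mem_Iic]; have := hlev j (by omega); omega) (hlDec j hj))
    (fun j hj => (hHc j).comp_continuousOn (hPM.cont.mono (hlI j hj)))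
    (fun j hj x hx => by
      refine ⟨hHsec j (F x) (hFI x (hlI j hj hx)) (fun h => ?_) (fun h => ?_), fun h => ?_⟩
      · exact (hlMax j hj (by omega)).2 (mem_image_of_mem F hx)
      · exact (hlMin j hj (by omega)).2 (mem_image_of_mem F hx)
      · cases j with
        | zero => simp [hH]
        | succ j =>
          have h1 : l (j + 1) ≤ m := by
            have := hlDec j (by omega)
            have := hlev j (by omega)
            omega
          exact (h.not_ge (hx.2.trans (hmono.monotoneOn (by simp only [mem_Iic]; omega)
            (by simp only [mem_Iic]; omega) h1))).elim)
    (fun j hj => hagree j _ (hlVal01 (j + 1) (by omega)) (hlVal23 (j + 1) (by omega)))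
  obtain ⟨G, hGc, hGR, hG0⟩ := exists_glue_right (y := fun j => c (r j))
    (f := fun j => H (j + 2) ∘ F) (R := fun x y => y ∈ Icc d e ∧ f y = F x) t
    (fun j hj => hmono (hrv j (by omega)) (hrv (j + 1) (by omega)) (hrInc j hj))
    (fun j hj => (hHc (j + 2)).comp_continuousOn (hPM.cont.mono (hrI j hj)))
    (fun j hj x hx => by
      refine hHsec (j + 2) (F x) (hFI x (hrI j hj hx)) (fun h => ?_) (fun h => ?_)
      · exact (hrMax j hj (by omega)).2 (mem_image_of_mem F hx)
      · exact (hrMin j hj (by omega)).2 (mem_image_of_mem F hx))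
    (fun j hj => hagree (j + 2) _ (fun h => hrVal23 (j + 1) (by omega) (by omega))
      (fun h => hrVal01 (j + 1) (by omega) (by omega)))
  simp only [hl0, hlLast, hr0, hrLast, hPM.c_zero, hPM.c_last, ← hd, ← he]
    at hLc hLR hL0 hGc hGR hG0
  have hLd : L d = f d := by
    rw [hL0, hfd]
    simpa [hH] using hH₀q
  have hGe : f e = G e := by
    rw [hG0, hfe]
    simpa [hH] using hH₂p.symm
  have hde : d < e := hdα.trans (hαβ.trans hβe)
  set φ : ℝ → ℝ := fun x => if x ≤ d then L x else if x ≤ e then f x else G x with hφ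
  have hφL : EqOn φ L (Icc a d) := fun x hx => if_pos hx.2
  have hφf : EqOn φ f (Icc d e) := fun x hx => by
    rcases hx.1.eq_or_lt with h | h
    · rw [← h, ← hLd]
      exact if_pos le_rfl
    · simp [hφ, h.not_ge, hx.2]
  have hφG : EqOn φ G (Icc e b) := fun x hx => by
    rcases hx.1.eq_or_lt with h | h
    · rw [← h, ← hGe]
      exact hφf ⟨hde.le, le_rfl⟩
    · simp [hφ, h.not_ge, (hde.trans h).not_ge]
  have hφcont : ContinuousOn φ (Icc a b) :=
    hLc.ite_le_Icc (hfc.ite_le_Icc hGc hGe) (by simp [hLd, hde.le])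
  have hφR : ∀ x ∈ Icc a b, φ x ∈ Icc d e ∧ f (φ x) = F x := by
    intro x hx
    rcases le_total x d with h1 | h1
    · rw [hφL ⟨hx.1, h1⟩]
      exact (hLR x ⟨hx.1, h1⟩).1
    rcases le_total x e with h2 | h2
    · rw [hφf ⟨h1, h2⟩]
      exact ⟨hfmaps ⟨h1, h2⟩, hff x ⟨h1, h2⟩⟩
    · rw [hφG ⟨h2, hx.2⟩]
      exact hGR x ⟨h2, hx.2⟩
  have hφφ : ∀ x ∈ Icc a b, φ (φ x) = F x := fun x hx =>
    (hφf (hφR x hx).1).trans (hφR x hx).2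
  have hφl : StrictMonoOn φ (Icc d α) :=
    hfl.congr fun x hx => (hφf ⟨hx.1, hx.2.trans (hαβ.trans hβe).le⟩).symm
  have hφm : StrictAntiOn φ (Icc α β) :=
    hfm.congr fun x hx => (hφf ⟨hdα.le.trans hx.1, hx.2.trans hβe.le⟩).symm
  have hφα : IsFort a b φ α :=
    isFort_of_strictMonoOn_strictAntiOn hda.1 hdα hαβ (hβe.le.trans hea.2) hφl hφm
  have hcm : c m < d := hPM.c_mono m (by omega)
  have hFm : StrictMonoOn F (Icc (c m) d) := by
    refine hPM.strictMonoOn_lap (by omega)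
      ((hlMax 0 s.zero_le (.inl rfl)).2 (mem_image_of_mem F ?_))
    have := hlDec 0 s.zero_le
    rw [hl0] at this ⊢
    exact ⟨hmono.monotoneOn (by simp only [mem_Iic]; omega) (by simp only [mem_Iic]; omega)
      (by omega), hcm.le⟩
  obtain ⟨w, hmw, hwd⟩ := exists_between hcm
  have hφw : StrictMonoOn φ (Icc w d) := by
    have hwa : a ≤ w := (hPM.mem_Icc (i := m) (by omega)).1.trans hmw.le
    have hval : EqOn φ (H₀ ∘ F) (Icc w d) := fun x hx =>
      (hφL ⟨hwa.trans hx.1, hx.2⟩).trans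
        ((hLR x ⟨hwa.trans hx.1, hx.2⟩).2 (hmw.trans_le hx.1))
    exact ((hH₀.comp_strictMonoOn hFm).mono (Icc_subset_Icc hmw.le le_rfl)).congr hval.symm
  have hφd : ¬ IsFort a b φ d := by
    refine not_isFort_of_mem_Ioo (d := w) (e := α) (.inl ?_) ⟨hwd, hdα⟩
    rw [← Icc_union_Icc_eq_Icc hwd.le hdα.le]
    exact hφw.union hφl (isGreatest_Icc hwd.le) (isLeast_Icc hdα.le)
  exact ⟨φ, hφcont, fun x hx => hM (hφR x hx).1, hφφ, hφm,
    heightEq_two_of_sqrt hφcont hφφ hPM.finite_setOf_isFort hφm hK hφα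
      (hPM.fort (m + 1) (by omega) (by omega)) hφd⟩
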